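/- arXiv:1606.08485 — 8 statements merged into one kernel-verified Lean document; each statement's English description precedes it below -/
import Mathlib

section
/- For every n ≥ 2, the n×n rooks graph G = K_n □ K_n satisfies c_L(G) = γ(G) = n and c(G) = 2. -/
/-!
Cops and robbers on a simple graph `G`.

A *configuration* consists of the positions of the `k` cops (a function
`Fin k → V`) together with the robber's position, with the cops to move.
The cops win if at some point a cop occupies the robber's vertex.
-/

namespace CopsRobbers

variable {V : Type*}

/-- From cop positions `c` and robber position `r`, with the cops to move,
the cops (each of whom may move along an edge or stay put on the cops' turn)
can guarantee to catch the robber.  Either a cop is already on the robber,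
or the cops can move so that a cop lands on the robber, or the cops can move
so that whatever (legal) move the robber then makes, the resulting
configuration is again winning for the cops. -/
inductive CopsWinFrom (G : SimpleGraph V) {k : ℕ} : (Fin k → V) → V → Prop
  | caught {c : Fin k → V} {r : V} (i : Fin k) (h : c i = r) : CopsWinFrom G c r
  | stepCatch {c : Fin k → V} {r : V} (c' : Fin k → V)
      (hmove : ∀ i, c' i = c i ∨ G.Adj (c i) (c' i))
      (i : Fin k) (h : c' i = r) : CopsWinFrom G c r
  | step {c : Fin k → V} {r : V} (c' : Fin k → V)
      (hmove : ∀ i, c' i = c i ∨ G.Adj (c i) (c' i))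
      (hnext : ∀ r', (r' = r ∨ G.Adj r r') → CopsWinFrom G c' r') :
      CopsWinFrom G c r

/-- `k` cops have a winning strategy on `G` in the ordinary game: they choose
starting positions, and then whatever vertex the robber starts on, they can
catch him. -/
def CopsWin (G : SimpleGraph V) (k : ℕ) : Prop :=
  ∃ c₀ : Fin k → V, ∀ r₀ : V, CopsWinFrom G c₀ r₀

/-- The cop number `c(G)`: the least number of cops that have a winning
strategy on `G`. -/
noncomputable def copNumber (G : SimpleGraph V) : ℕ :=
  sInf {k | CopsWin G k}

/-- The lazy variant: from cop positions `c` and robber position `r`, with the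
cops to move, the cops can catch the robber, where on each cops' turn at most
one cop (cop `j`) moves along an edge (all others stay put). -/
inductive LazyWinFrom (G : SimpleGraph V) {k : ℕ} : (Fin k → V) → V → Prop
  | caught {c : Fin k → V} {r : V} (i : Fin k) (h : c i = r) : LazyWinFrom G c r
  | stepCatch {c : Fin k → V} {r : V} (c' : Fin k → V) (j : Fin k)
      (hmove : c' j = c j ∨ G.Adj (c j) (c' j))
      (hfix : ∀ i, i ≠ j → c' i = c i)
      (i : Fin k) (h : c' i = r) : LazyWinFrom G c r
  | step {c : Fin k → V} {r : V} (c' : Fin k → V) (j : Fin k)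
      (hmove : c' j = c j ∨ G.Adj (c j) (c' j))
      (hfix : ∀ i, i ≠ j → c' i = c i)
      (hnext : ∀ r', (r' = r ∨ G.Adj r r') → LazyWinFrom G c' r') :
      LazyWinFrom G c r

/-- `k` lazy cops have a winning strategy on `G`. -/
def LazyCopsWin (G : SimpleGraph V) (k : ℕ) : Prop :=
  ∃ c₀ : Fin k → V, ∀ r₀ : V, LazyWinFrom G c₀ r₀

/-- The lazy cop number `c_L(G)`. -/
noncomputable def lazyCopNumber (G : SimpleGraph V) : ℕ :=
  sInf {k | LazyCopsWin G k}

/-- A dominating set: every vertex is in `S` or adjacent to a member of `S`. -/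
def IsDominatingSet (G : SimpleGraph V) (S : Set V) : Prop :=
  ∀ v : V, v ∈ S ∨ ∃ u ∈ S, G.Adj u v

/-- The domination number `γ(G)`: the least size of a dominating set. -/
noncomputable def dominationNumber (G : SimpleGraph V) [Fintype V] : ℕ :=
  sInf {m | ∃ S : Finset V, S.card = m ∧ IsDominatingSet G ↑S}

/-- The `n × n` rooks graph `K_n □ K_n`. -/
def rooksGraph (n : ℕ) : SimpleGraph (Fin n × Fin n) :=
  SimpleGraph.boxProd ⊤ ⊤


theorem rooksGraph_adj {n : ℕ} {p q : Fin n × Fin n} :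
    (rooksGraph n).Adj p q ↔ (p.1 ≠ q.1 ∧ p.2 = q.2) ∨ (p.2 ≠ q.2 ∧ p.1 = q.1) := by
  simp [rooksGraph, SimpleGraph.boxProd_adj]

/-- A vertex is in the closed neighbourhood of every vertex of its row and of its column. -/
theorem rooksGraph_eq_or_adj {n : ℕ} {p q : Fin n × Fin n} (h : p.1 = q.1 ∨ p.2 = q.2) :
    q = p ∨ (rooksGraph n).Adj p q := by
  rw [rooksGraph_adj, Prod.ext_iff]
  grind

/-- Two vertices that agree or are adjacent share a row or a column. -/
theorem rooksGraph_fst_eq_or_snd_eq {n : ℕ} {p q : Fin n × Fin n}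
    (h : q = p ∨ (rooksGraph n).Adj p q) : p.1 = q.1 ∨ p.2 = q.2 := by
  rw [rooksGraph_adj, Prod.ext_iff] at h
  grind

theorem exists_forall_ne_of_card_lt {ι α : Type*} [Fintype ι] [Fintype α]
    (h : Fintype.card ι < Fintype.card α) (f : ι → α) : ∃ a, ∀ i, f i ≠ a := by
  by_contra! hf
  exact h.not_ge (Fintype.card_le_of_surjective f hf)

/-- Fewer than `n` rooks leave some vertex whose row and column are both empty. -/
theorem exists_forall_fst_ne_and_snd_ne {n : ℕ} {ι : Type*} [Fintype ι]
    (h : Fintype.card ι < n) (c : ι → Fin n × Fin n) :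
    ∃ r : Fin n × Fin n, ∀ i, (c i).1 ≠ r.1 ∧ (c i).2 ≠ r.2 := by
  have h' : Fintype.card ι < Fintype.card (Fin n) := by simpa using h
  obtain ⟨x, hx⟩ := exists_forall_ne_of_card_lt h' fun i => (c i).1
  obtain ⟨y, hy⟩ := exists_forall_ne_of_card_lt h' fun i => (c i).2
  exact ⟨(x, y), fun i => ⟨hx i, hy i⟩⟩

/-- Cops starting on a dominating set catch the robber with their first move. -/
theorem IsDominatingSet.lazyCopsWin {G : SimpleGraph V} {S : Finset V}
    (hS : IsDominatingSet G ↑S) : LazyCopsWin G S.card := by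
  refine ⟨fun i => (S.equivFin.symm i : V), fun r => ?_⟩
  rcases hS r with hr | ⟨u, hu, hur⟩
  · exact .caught (S.equivFin ⟨r, hr⟩) (by simp)
  · set j := S.equivFin ⟨u, hu⟩ with hj
    refine .stepCatch (Function.update (fun i => (S.equivFin.symm i : V)) j r) j ?_ ?_ j ?_
    · simpa [hj] using Or.inr hur
    · intro i hi
      simp [hi]
    · simp

theorem isDominatingSet_column {n : ℕ} (y : Fin n) :
    IsDominatingSet (rooksGraph n) ↑(Finset.univ.image fun x : Fin n => (x, y)) := by
  intro v
  have hmem : (v.1, y) ∈ (↑(Finset.univ.image fun x : Fin n => (x, y)) : Set (Fin n × Fin n)) := by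
    simp
  rcases rooksGraph_eq_or_adj (p := (v.1, y)) (q := v) (.inl rfl) with h | h
  · exact .inl (h ▸ hmem)
  · exact .inr ⟨_, hmem, h⟩

theorem card_column {n : ℕ} (y : Fin n) :
    (Finset.univ.image fun x : Fin n => (x, y)).card = n := by
  rw [Finset.card_image_of_injective _ (Prod.mk_left_injective y), Finset.card_fin]

theorem IsDominatingSet.le_card {n : ℕ} {S : Finset (Fin n × Fin n)}
    (hS : IsDominatingSet (rooksGraph n) ↑S) : n ≤ S.card := by
  by_contra! h
  obtain ⟨r, hr⟩ := exists_forall_fst_ne_and_snd_ne (ι := S) (by simpa using h) Subtype.val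
  have hfree : ∀ u ∈ S, ¬ (u.1 = r.1 ∨ u.2 = r.2) := fun u hu =>
    not_or.2 (hr ⟨u, hu⟩)
  rcases hS r with h | ⟨u, hu, hur⟩
  · exact hfree r h (.inl rfl)
  · exact hfree u hu (rooksGraph_fst_eq_or_snd_eq (.inr hur))

/-- A robber facing fewer than `n` lazy cops, none of them in his row or column, is never caught:
whenever a cop enters his row, he moves along his column to an empty row, and vice versa. -/
theorem not_lazyWinFrom_rooksGraph {n k : ℕ} (hk : k < n) {c : Fin k → Fin n × Fin n}
    {r : Fin n × Fin n} (hr : ∀ i, (c i).1 ≠ r.1 ∧ (c i).2 ≠ r.2) :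
    ¬ LazyWinFrom (rooksGraph n) c r := by
  intro hwin
  induction hwin with
  | caught i h => exact (hr i).1 (congrArg Prod.fst h)
  | @stepCatch c r c' j hmove hfix i h =>
    by_cases hij : i = j
    · subst hij
      have := rooksGraph_fst_eq_or_snd_eq hmove
      grind
    · exact (hr i).1 (by rw [← hfix i hij, h])
  | @step c r c' j hmove hfix _ ih =>
    have hj := rooksGraph_fst_eq_or_snd_eq hmove
    obtain ⟨f, hf⟩ := exists_forall_fst_ne_and_snd_ne (by simpa using hk) c'
    by_cases hrow : (c' j).1 = r.1
    · refine ih (f.1, r.2) (rooksGraph_eq_or_adj (.inr rfl)) fun i => ⟨(hf i).1, ?_⟩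
      grind
    by_cases hcol : (c' j).2 = r.2
    · refine ih (r.1, f.2) (rooksGraph_eq_or_adj (.inl rfl)) fun i => ⟨?_, (hf i).2⟩
      grind
    · refine ih r (.inl rfl) fun i => ?_
      grind

theorem LazyCopsWin.le_of_rooksGraph {n k : ℕ} (h : LazyCopsWin (rooksGraph n) k) : n ≤ k := by
  by_contra! hk
  obtain ⟨c, hc⟩ := h
  obtain ⟨r, hr⟩ := exists_forall_fst_ne_and_snd_ne (by simpa using hk) c
  exact not_lazyWinFrom_rooksGraph hk hr (hc r)

theorem CopsWinFrom.pos {G : SimpleGraph V} {k : ℕ} {c : Fin k → V} {r : V}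
    (h : CopsWinFrom G c r) : 0 < k := by
  induction h with
  | caught i _ => exact i.pos
  | stepCatch _ _ i _ => exact i.pos
  | @step _ r _ _ _ ih => exact ih r (.inl rfl)

/-- A single cop is automatically lazy. -/
theorem CopsWinFrom.lazyWinFrom {G : SimpleGraph V} {c : Fin 1 → V} {r : V}
    (h : CopsWinFrom G c r) : LazyWinFrom G c r := by
  induction h with
  | caught i h => exact .caught i h
  | stepCatch c' hmove i h =>
    exact .stepCatch c' 0 (hmove 0) (fun i hi => absurd (Subsingleton.elim i 0) hi) i h
  | step c' hmove _ ih =>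
    exact .step c' 0 (hmove 0) (fun i hi => absurd (Subsingleton.elim i 0) hi) ih

theorem CopsWin.two_le_of_rooksGraph {n k : ℕ} (hn : 2 ≤ n) (h : CopsWin (rooksGraph n) k) :
    2 ≤ k := by
  obtain ⟨c, hc⟩ := h
  have hpos := (hc (⟨0, by omega⟩, ⟨0, by omega⟩)).pos
  by_contra! hk
  obtain rfl : k = 1 := by omega
  have := LazyCopsWin.le_of_rooksGraph ⟨c, fun r => (hc r).lazyWinFrom⟩
  omega

/-- A cop that shares a row or a column with the robber catches him. -/
theorem copsWinFrom_rooksGraph {n k : ℕ} {c : Fin k → Fin n × Fin n} {r : Fin n × Fin n}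
    (i : Fin k) (h : (c i).1 = r.1 ∨ (c i).2 = r.2) : CopsWinFrom (rooksGraph n) c r := by
  refine .stepCatch (Function.update c i r) (fun j => ?_) i (by simp)
  by_cases hj : j = i
  · subst hj
    simpa using rooksGraph_eq_or_adj h
  · simp [hj]

/-- Two cops win by guarding the robber's row with one cop and his column with the other. -/
theorem copsWin_two_rooksGraph {n : ℕ} (v : Fin n × Fin n) : CopsWin (rooksGraph n) 2 := by
  refine ⟨fun _ => v, fun r => .step ![(r.1, v.2), (v.1, r.2)] (fun i => ?_) fun r' hr' => ?_⟩
  · fin_cases i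
    · exact rooksGraph_eq_or_adj (.inr rfl)
    · exact rooksGraph_eq_or_adj (.inl rfl)
  · rcases rooksGraph_fst_eq_or_snd_eq hr' with h | h
    · exact copsWinFrom_rooksGraph 0 (.inl h)
    · exact copsWinFrom_rooksGraph 1 (.inr h)

/-- For every `n ≥ 2`, the `n × n` rooks graph `K_n □ K_n`
satisfies `c_L = γ = n` and `c = 2`. -/
theorem rooksGraph_lazyCopNumber_dominationNumber_copNumber
    (n : ℕ) (hn : 2 ≤ n) :
    lazyCopNumber (rooksGraph n) = n ∧ dominationNumber (rooksGraph n) = n ∧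
      copNumber (rooksGraph n) = 2 := by
  have hcol := isDominatingSet_column (⟨0, by omega⟩ : Fin n)
  have hcard := card_column (⟨0, by omega⟩ : Fin n)
  have hlazy : LazyCopsWin (rooksGraph n) n := by
    simpa only [hcard] using hcol.lazyCopsWin
  have htwo : CopsWin (rooksGraph n) 2 :=
    copsWin_two_rooksGraph (⟨0, by omega⟩, ⟨0, by omega⟩)
  refine ⟨IsLeast.csInf_eq ⟨hlazy, fun k hk => hk.le_of_rooksGraph⟩,
    IsLeast.csInf_eq ⟨⟨_, hcard, hcol⟩, ?_⟩,
    IsLeast.csInf_eq ⟨htwo, fun k hk => hk.two_le_of_rooksGraph hn⟩⟩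
  rintro _ ⟨S, rfl, hS⟩
  exact hS.le_card

end CopsRobbers
end

section
/- Let G = (V,E) be a finite connected simple graph with a vertex v of degree 1, whose unique incident edge is uv. Let G' be the graph on V − {v} with edge set E − {uv}. Then c_L(G') = c_L(G). -/
/-!
Cops and robbers on a simple graph `G`.

A *configuration* consists of the positions of the `k` cops (a function
`Fin k → V`) together with the robber's position, with the cops to move.
The cops win if at some point a cop occupies the robber's vertex.
-/

namespace CopsRobbers

variable {V : Type*}

/-- A map sending edges to edges or single vertices, and which retracts onto an embedded graph,
carries lazy winning positions to lazy winning positions. -/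
theorem LazyWinFrom.map_retraction {W : Type*} {G : SimpleGraph V} {H : SimpleGraph W}
    (e : H ↪g G) (f : V → W) (hf : ∀ a b, G.Adj a b → f b = f a ∨ H.Adj (f a) (f b))
    (hfe : ∀ w, f (e w) = w) {k : ℕ} {c : Fin k → V} {r : V} (h : LazyWinFrom G c r) :
    ∀ s : W, e s = r → LazyWinFrom H (f ∘ c) s := by
  induction h with
  | caught i h =>
    intro s hs
    exact .caught i (by rw [Function.comp_apply, h, ← hs, hfe])
  | stepCatch c' j hmove hfix i h =>
    intro s hs
    exact .stepCatch (f ∘ c') j (hmove.elim (fun h => .inl (congrArg f h)) (hf _ _))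
      (fun i hi => congrArg f (hfix i hi)) i (by rw [Function.comp_apply, h, ← hs, hfe])
  | step c' j hmove hfix hnext ih =>
    intro s hs
    refine .step (f ∘ c') j (hmove.elim (fun h => .inl (congrArg f h)) (hf _ _))
      (fun i hi => congrArg f (hfix i hi)) fun s' hs' => ih (e s') ?_ s' rfl
    subst hs
    exact hs'.imp (congrArg e) e.map_adj_iff.2

/-- If a retraction moves every vertex by at most one edge, and every vertex it does move is a
leaf attached to its image, then catching the image of the robber suffices to catch the robber. -/
theorem LazyWinFrom.of_retraction {W : Type*} {G : SimpleGraph V} {H : SimpleGraph W}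
    (e : H ↪g G) (f : V → W) (hf : ∀ a b, G.Adj a b → f b = f a ∨ H.Adj (f a) (f b))
    (hleaf : ∀ a, e (f a) = a ∨ G.neighborSet a = {e (f a)})
    {k : ℕ} {d : Fin k → W} {s : W} (h : LazyWinFrom H d s) :
    ∀ r : V, f r = s → LazyWinFrom G (e ∘ d) r := by
  have near : ∀ (d : Fin k → W) (i : Fin k) (r : V),
      (e (d i) = r ∨ G.Adj r (e (d i))) → LazyWinFrom G (e ∘ d) r := by
    rintro d i r (h | h)
    · exact .caught i h
    · exact .stepCatch (Function.update (e ∘ d) i r) i (.inr (by simpa using h.symm))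
        (fun j hj => Function.update_of_ne hj _ _) i (Function.update_self ..)
  have leaf_adj : ∀ {a : V}, G.neighborSet a = {e (f a)} → G.Adj a (e (f a)) := fun {a} ha =>
    (G.mem_neighborSet a _).1 (ha ▸ rfl)
  have move : ∀ {x y : W}, (y = x ∨ H.Adj x y) → (e y = e x ∨ G.Adj (e x) (e y)) :=
    fun h => h.imp (congrArg e) e.map_adj_iff.2
  induction h with
  | caught i h =>
    rintro r rfl
    apply near _ i
    rw [h]
    exact (hleaf r).imp id leaf_adj
  | stepCatch d' j hmove hfix i h =>
    rintro r rfl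
    have hfix' : ∀ i, i ≠ j → (e ∘ d') i = (e ∘ _) i := fun i hi => congrArg e (hfix i hi)
    rcases hleaf r with hr | hr
    · exact .stepCatch (e ∘ d') j (move hmove) hfix' i (by rw [Function.comp_apply, h, hr])
    · refine .step (e ∘ d') j (move hmove) hfix' ?_
      rintro r' (rfl | hr')
      · exact near _ i _ (.inr (h ▸ leaf_adj hr))
      · have : r' = e (f r) := by rwa [← G.mem_neighborSet, hr] at hr'
        exact near _ i _ (.inl (by rw [h, this]))
  | step d' j hmove hfix hnext ih =>
    rintro r rfl
    refine .step (e ∘ d') j (move hmove) (fun i hi => congrArg e (hfix i hi)) fun r' hr' =>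
      ih (f r') ?_ r' rfl
    exact hr'.elim (fun h => .inl (congrArg f h)) (hf _ _)

/-- if `v` has degree 1 with unique incident edge `uv`, then
deleting `v` (together with its edge) does not change the lazy cop number. -/
theorem lazyCopNumber_delete_degree_one_vertex
    {V : Type*} [Fintype V] (G : SimpleGraph V) (hconn : G.Connected)
    (u v : V) (huv : G.neighborSet v = {u}) :
    lazyCopNumber (G.induce {w : V | w ≠ v}) = lazyCopNumber G := by
  classical
  have hadj : ∀ w, G.Adj v w ↔ w = u := fun w => by
    rw [← G.mem_neighborSet, huv, Set.mem_singleton_iff]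
  have hu : u ≠ v := ((hadj u).2 rfl).ne'
  let e : G.induce {w : V | w ≠ v} ↪g G := SimpleGraph.Embedding.induce _
  let f : V → {w : V | w ≠ v} := fun a => if h : a = v then ⟨u, hu⟩ else ⟨a, h⟩
  have hfv : f v = ⟨u, hu⟩ := dif_pos rfl
  have hfn : ∀ {a : V} (h : a ≠ v), f a = ⟨a, h⟩ := fun h => dif_neg h
  have hf : ∀ a b, G.Adj a b → f b = f a ∨ (G.induce {w : V | w ≠ v}).Adj (f a) (f b) := by
    intro a b hab
    by_cases ha : a = v
    · subst ha
      obtain rfl := (hadj b).1 hab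
      exact .inl (by rw [hfv, hfn hu])
    · by_cases hb : b = v
      · subst hb
        obtain rfl := (hadj a).1 hab.symm
        exact .inl (by rw [hfv, hfn hu])
      · exact .inr (by rw [hfn ha, hfn hb]; exact hab)
  have hleaf : ∀ a, e (f a) = a ∨ G.neighborSet a = {e (f a)} := by
    intro a
    by_cases ha : a = v
    · subst ha
      exact .inr (by rw [hfv]; exact huv)
    · exact .inl (by rw [hfn ha]; rfl)
  have key : ∀ k, LazyCopsWin (G.induce {w : V | w ≠ v}) k ↔ LazyCopsWin G k := fun k =>
    ⟨fun ⟨d, hd⟩ => ⟨e ∘ d, fun r => (hd (f r)).of_retraction e f hf hleaf r rfl⟩,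
      fun ⟨c, hc⟩ => ⟨f ∘ c, fun s =>
        (hc (e s)).map_retraction e f hf (fun w => hfn w.2) s rfl⟩⟩
  simp only [lazyCopNumber, key]

end CopsRobbers
end

section
/- If G is a finite connected simple graph on at most 8 vertices, then c_L(G) ≤ 2. -/
/-!
Cops and robbers on a simple graph `G`.

A *configuration* consists of the positions of the `k` cops (a function
`Fin k → V`) together with the robber's position, with the cops to move.
The cops win if at some point a cop occupies the robber's vertex.
-/

namespace CopsRobbers

variable {V : Type*}

/-- One cop at `c` can catch a robber at `r`, the cop to move, when the robber may only
use vertices of `S`. -/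
inductive ConfinedWin (G : SimpleGraph V) (S : Finset V) : V → V → Prop
  | caught (r : V) : ConfinedWin G S r r
  | stepCatch {c r : V} (h : G.Adj c r) : ConfinedWin G S c r
  | step {c r : V} (c' : V) (hmove : c' = c ∨ G.Adj c c')
      (hnext : ∀ r' ∈ S, (r' = r ∨ G.Adj r r') → ConfinedWin G S c' r') : ConfinedWin G S c r

/-- The vertex `u` of `T` dominates the vertex `x` within `T`. -/
def DominatesWithin (G : SimpleGraph V) (T : Finset V) (u x : V) : Prop :=
  u ∈ T ∧ u ≠ x ∧ ∀ y ∈ T, (y = x ∨ G.Adj x y) → (y = u ∨ G.Adj u y)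

/-- A nonempty set of vertices, none of which is isolated or dominated within the set. -/
structure IsStiff (G : SimpleGraph V) (T : Finset V) : Prop where
  nonempty : T.Nonempty
  not_isolated : ∀ x ∈ T, ∃ y ∈ T, G.Adj x y
  not_dominated : ∀ x ∈ T, ∀ u, ¬ DominatesWithin G T u x

theorem ConfinedWin.of_isolated {G : SimpleGraph V} (hconn : G.Connected) {S : Finset V} {x : V}
    (hx : ∀ y ∈ S, ¬ G.Adj x y) (c : V) : ConfinedWin G S c x := by
  obtain ⟨w⟩ := hconn.preconnected c x
  induction w with
  | nil => exact .caught _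
  | cons h _ ih =>
    refine .step _ (Or.inr h) fun r' hr' hadj => ?_
    rcases hadj with rfl | hadj
    · exact ih hx
    · exact absurd hadj (hx r' hr')

theorem ConfinedWin.of_erase_isolated [DecidableEq V] {G : SimpleGraph V} {S : Finset V} {x : V}
    (hx : ∀ y ∈ S, ¬ G.Adj x y) {c r : V} (h : ConfinedWin G (S.erase x) c r) (hr : r ∈ S)
    (hrx : r ≠ x) : ConfinedWin G S c r := by
  induction h with
  | caught r => exact .caught r
  | stepCatch h => exact .stepCatch h
  | @step c r c' hmove _ ih =>
    refine .step c' hmove fun r' hr' hadj => ?_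
    have hne : r' ≠ x := by
      rintro rfl
      rcases hadj with rfl | hadj
      · exact hrx rfl
      · exact hx r hr hadj.symm
    exact ih r' (Finset.mem_erase.2 ⟨hne, hr'⟩) hadj hr' hne

/-- The cop plays against the robber's image under the retraction sending `x` to `u`. -/
theorem ConfinedWin.of_erase_dominated [DecidableEq V] {G : SimpleGraph V} {S : Finset V}
    {u x : V} (hux : DominatesWithin G S u x) {c s : V} (h : ConfinedWin G (S.erase x) c s) :
    ∀ r ∈ S, s = (if r = x then u else r) → ConfinedWin G S c r := by
  obtain ⟨huS, hne, hdom⟩ := hux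
  have shadow_caught : ConfinedWin G S u x := by
    refine .step u (Or.inl rfl) fun r' hr' hadj => ?_
    rcases hdom r' hr' hadj with rfl | h
    · exact .caught _
    · exact .stepCatch h
  induction h with
  | caught s =>
    rintro r hr rfl
    split_ifs with h
    · exact h ▸ shadow_caught
    · exact .caught r
  | @stepCatch c s h =>
    rintro r hr rfl
    split_ifs at h with hrx
    · subst hrx
      refine .step u (Or.inr h) fun r' hr' hadj => ?_
      rcases hdom r' hr' hadj with rfl | h
      · exact .caught _
      · exact .stepCatch h
    · exact .stepCatch h
  | @step c s c' hmove _ ih =>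
    rintro r hr rfl
    refine .step c' hmove fun r' hr' hadj => ?_
    refine ih (if r' = x then u else r') ?_ ?_ r' hr' rfl
    · split_ifs with h
      · exact Finset.mem_erase.2 ⟨hne, huS⟩
      · exact Finset.mem_erase.2 ⟨h, hr'⟩
    · split_ifs with h h' h'
      · exact Or.inl rfl
      · subst h
        have hrx : r = r' ∨ G.Adj r' r := hadj.imp Eq.symm SimpleGraph.Adj.symm
        exact (hdom r hr hrx).imp Eq.symm SimpleGraph.Adj.symm
      · subst h'
        exact hdom r' hr' hadj
      · exact hadj

theorem confinedWin_of_no_stiff {G : SimpleGraph V} (hconn : G.Connected) (S : Finset V)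
    (hS : ∀ T ⊆ S, ¬ IsStiff G T) (c r : V) (hr : r ∈ S) : ConfinedWin G S c r := by
  classical
  induction S using Finset.strongInduction generalizing r with
  | H S ih =>
    have ih' (x : V) (hx : x ∈ S) (r : V) (hr : r ∈ S.erase x) : ConfinedWin G (S.erase x) c r :=
      ih _ (Finset.erase_ssubset hx) (fun T hT => hS T (hT.trans (Finset.erase_subset _ _))) r hr
    by_cases hiso : ∃ x ∈ S, ∀ y ∈ S, ¬ G.Adj x y
    · obtain ⟨x, hxS, hx⟩ := hiso
      by_cases hrx : r = x
      · exact hrx ▸ .of_isolated hconn hx c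
      · exact .of_erase_isolated hx (ih' x hxS r (Finset.mem_erase.2 ⟨hrx, hr⟩)) hr hrx
    by_cases hdom : ∃ x ∈ S, ∃ u, DominatesWithin G S u x
    · obtain ⟨x, hxS, u, hux⟩ := hdom
      refine .of_erase_dominated hux (ih' x hxS (if r = x then u else r) ?_) r hr rfl
      split_ifs with h
      · exact Finset.mem_erase.2 ⟨hux.2.1, hux.1⟩
      · exact Finset.mem_erase.2 ⟨h, hr⟩
    push Not at hiso hdom
    exact absurd ⟨⟨r, hr⟩, hiso, hdom⟩ (hS S subset_rfl)

/-- A second cop guarding the closed neighbourhood of `v` confines the robber to `S`. -/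
theorem ConfinedWin.lazyWinFrom {G : SimpleGraph V} {S : Finset V} {v : V}
    (hS : ∀ y, y ∈ S ∨ y = v ∨ G.Adj v y) {c r : V} (h : ConfinedWin G S c r) :
    LazyWinFrom G ![v, c] r := by
  induction h with
  | caught r => exact .caught 1 rfl
  | @stepCatch c r h =>
    exact .stepCatch ![v, r] 1 (Or.inr h) (by simp [Fin.forall_fin_two]) 1 rfl
  | @step c r c' hmove _ ih =>
    refine .step ![v, c'] 1 hmove (by simp [Fin.forall_fin_two]) fun r' hadj => ?_
    rcases hS r' with h | rfl | h
    · exact ih r' h hadj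
    · exact .caught 0 rfl
    · exact .stepCatch ![r', c'] 0 (Or.inr h) (by simp [Fin.forall_fin_two]) 0 rfl

theorem exists_stiff_of_not_lazyCopsWin {G : SimpleGraph V} (hconn : G.Connected)
    (hG : ¬ LazyCopsWin G 2) {v : V} {S : Finset V} (hS : ∀ y, y ∈ S ∨ y = v ∨ G.Adj v y) :
    ∃ T ⊆ S, IsStiff G T := by
  by_contra! hno
  refine hG ⟨![v, v], fun r => ?_⟩
  rcases hS r with h | rfl | h
  · exact (confinedWin_of_no_stiff hconn S hno v r h).lazyWinFrom hS
  · exact .caught 0 rfl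
  · exact .stepCatch ![r, v] 0 (Or.inr h) (by simp [Fin.forall_fin_two]) 0 rfl

theorem IsStiff.two_le_card_neighbors [Fintype V] [DecidableEq V] {G : SimpleGraph V}
    [DecidableRel G.Adj] {T : Finset V} (hT : IsStiff G T) {x : V} (hx : x ∈ T) :
    2 ≤ (G.neighborFinset x ∩ T).card := by
  obtain ⟨y, hy, hxy⟩ := hT.not_isolated x hx
  by_contra! hlt
  refine hT.not_dominated x hx y ⟨hy, hxy.ne', fun z hz hxz => ?_⟩
  rcases hxz with rfl | hxz
  · exact Or.inr hxy.symm
  · exact Or.inl (Finset.card_le_one.1 (Nat.le_of_lt_succ hlt) z (by simp [hxz, hz]) y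
      (by simp [hxy, hy]))

theorem IsStiff.four_le_card [Fintype V] {G : SimpleGraph V} {T : Finset V} (hT : IsStiff G T) :
    4 ≤ T.card := by
  classical
  obtain ⟨x, hx⟩ := hT.nonempty
  have h2 := hT.two_le_card_neighbors hx
  by_contra! hlt
  have hsub : G.neighborFinset x ∩ T ⊆ T.erase x := fun y hy => by
    simp only [Finset.mem_inter, SimpleGraph.mem_neighborFinset] at hy
    exact Finset.mem_erase.2 ⟨hy.1.ne', hy.2⟩
  have heq := Finset.eq_of_subset_of_card_le hsub (by rw [Finset.card_erase_of_mem hx]; omega)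
  obtain ⟨y, hy, hxy⟩ := hT.not_isolated x hx
  refine hT.not_dominated y hy x ⟨hx, hxy.ne, fun z hz _ => or_iff_not_imp_left.2 fun hzx => ?_⟩
  have hz' : z ∈ G.neighborFinset x ∩ T := heq ▸ Finset.mem_erase.2 ⟨hzx, hz⟩
  simpa using (Finset.mem_inter.1 hz').1

theorem exists_adj_mem_not_mem {G : SimpleGraph V} (hconn : G.Connected) {T : Finset V}
    {x y : V} (hx : x ∈ T) (hy : y ∉ T) : ∃ p ∈ T, ∃ a ∉ T, G.Adj p a := by
  obtain ⟨w⟩ := hconn.preconnected x y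
  obtain ⟨d, _, h₁, h₂⟩ := w.exists_boundary_dart (T : Set V) hx hy
  exact ⟨d.fst, h₁, d.snd, h₂, d.adj⟩

theorem lazyCopsWin_two_of_card_le_eight [Fintype V] {G : SimpleGraph V} (hconn : G.Connected)
    (hcard : Fintype.card V ≤ 8) : LazyCopsWin G 2 := by
  classical
  by_contra hG
  let R (v : V) : Finset V := (insert v (G.neighborFinset v))ᶜ
  have mem_R (v y : V) : y ∈ R v ↔ y ≠ v ∧ ¬ G.Adj v y := by simp [R]
  have hR (v y : V) : y ∈ R v ∨ y = v ∨ G.Adj v y := by rw [mem_R]; tauto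
  have card_R (v : V) : (R v).card + (G.degree v + 1) ≤ 8 := by
    have h := Finset.card_compl_add_card (insert v (G.neighborFinset v))
    rw [Finset.card_insert_of_notMem (by simp), SimpleGraph.card_neighborFinset_eq_degree] at h
    exact h.trans_le hcard
  have hstiff (v : V) : ∃ T ⊆ R v, IsStiff G T := exists_stiff_of_not_lazyCopsWin hconn hG (hR v)
  have hdeg (v : V) : G.degree v ≤ 3 := by
    obtain ⟨T, hTR, hT⟩ := hstiff v
    have := Finset.card_le_card hTR
    have := hT.four_le_card
    have := card_R v
    omega
  have degree_split (x : V) (A B : Finset V)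
      (h : Disjoint (G.neighborFinset x ∩ A) (G.neighborFinset x ∩ B)) :
      (G.neighborFinset x ∩ A).card + (G.neighborFinset x ∩ B).card ≤ 3 := by
    rw [← Finset.card_union_of_disjoint h]
    refine le_trans (Finset.card_le_card ?_) (hdeg x)
    exact Finset.union_subset Finset.inter_subset_left Finset.inter_subset_left
  have hboundary (v : V) : ∃ T ⊆ R v, IsStiff G T ∧ ∃ p ∈ T, G.degree p = 3 ∧
      (G.neighborFinset p ∩ T).card = 2 := by
    obtain ⟨T, hTR, hT⟩ := hstiff v
    obtain ⟨x, hx⟩ := hT.nonempty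
    have hv : v ∉ T := fun h => ((mem_R v v).1 (hTR h)).1 rfl
    obtain ⟨p, hp, a, ha, hpa⟩ := exists_adj_mem_not_mem hconn hx hv
    have h2 := hT.two_le_card_neighbors hp
    have hlt : (G.neighborFinset p ∩ T).card < G.degree p := by
      refine Finset.card_lt_card (Finset.ssubset_iff_of_subset Finset.inter_subset_left |>.2 ?_)
      exact ⟨a, by simpa using hpa, by simp [ha]⟩
    have := hdeg p
    exact ⟨T, hTR, hT, p, hp, by omega, by omega⟩
  have stiff_R (v : V) (hv : G.degree v = 3) {T : Finset V} (hTR : T ⊆ R v) (hT : IsStiff G T) :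
      T = R v := by
    refine Finset.eq_of_subset_of_card_le hTR ?_
    have := hT.four_le_card
    have := card_R v
    omega
  obtain ⟨v₀⟩ := hconn.nonempty
  obtain ⟨-, -, -, v, -, hv, -⟩ := hboundary v₀
  obtain ⟨T, hTR, hT, p, hp, hp3, hpT⟩ := hboundary v
  obtain rfl := stiff_R v hv hTR hT
  obtain ⟨T', hTR', hT'⟩ := hstiff p
  obtain rfl := stiff_R p hp3 hTR' hT'
  have hinter : (R v ∩ R p).card = 1 := by
    have hsplit : R v ∩ R p = (R v).erase p \ (G.neighborFinset p ∩ R v) := by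
      ext y
      simp only [Finset.mem_inter, Finset.mem_sdiff, Finset.mem_erase, mem_R p,
        SimpleGraph.mem_neighborFinset]
      tauto
    rw [hsplit, Finset.card_sdiff_of_subset, Finset.card_erase_of_mem hp, hpT]
    · have := hT.four_le_card
      have := card_R v
      omega
    · intro y hy
      simp only [Finset.mem_inter, SimpleGraph.mem_neighborFinset] at hy
      exact Finset.mem_erase.2 ⟨hy.1.ne', hy.2⟩
  obtain ⟨q, hq⟩ := Finset.card_eq_one.1 hinter
  obtain ⟨hqv, hqp⟩ := Finset.mem_inter.1 (hq ▸ Finset.mem_singleton_self q)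
  have h₁ := hT.two_le_card_neighbors hqv
  have h₂ := hT'.two_le_card_neighbors hqp
  have h₃ := degree_split q (R v) (R p) <| Finset.disjoint_left.2 fun z hz hz' => by
    simp only [Finset.mem_inter, SimpleGraph.mem_neighborFinset] at hz hz'
    have hzq : z ∈ ({q} : Finset V) := hq ▸ Finset.mem_inter.2 ⟨hz.2, hz'.2⟩
    exact hz.1.ne' (Finset.mem_singleton.1 hzq)
  omega

/-- a finite connected simple graph on at most 8 vertices has
`c_L(G) ≤ 2`. -/
theorem lazyCopNumber_le_two_of_card_le_eight
    {V : Type*} [Fintype V] (G : SimpleGraph V) (hconn : G.Connected)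
    (hcard : Fintype.card V ≤ 8) :
    lazyCopNumber G ≤ 2 := by
  exact Nat.sInf_le (lazyCopsWin_two_of_card_le_eight hconn hcard)

end CopsRobbers
end

section
/- If G is a finite connected simple graph on n vertices whose maximum degree satisfies Δ(G) ≥ n − 4, then c_L(G) ≤ 2. -/
/-!
Cops and robbers on a simple graph `G`.

A *configuration* consists of the positions of the `k` cops (a function
`Fin k → V`) together with the robber's position, with the cops to move.
The cops win if at some point a cop occupies the robber's vertex.
-/

namespace CopsRobbers

variable {V : Type*}

/-- Two lazy cops, one of them parked at `v`, win against a robber confined to a set `C` that is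
dominated by a vertex `u` and that he can only leave by moving into the closed neighbourhood
of `v`. -/
theorem lazyWinFrom_of_walk {G : SimpleGraph V} {v u : V} {C : Set V}
    (hdom : ∀ x ∈ C, x = u ∨ G.Adj u x)
    (hclosed : ∀ x ∈ C, ∀ y, G.Adj x y → y ∈ C ∨ y = v ∨ G.Adj v y)
    {a : V} (p : G.Walk a u) {r : V} (hr : r ∈ C) : LazyWinFrom G ![v, a] r := by
  induction p generalizing r with
  | nil =>
    refine .stepCatch ![v, r] 1 ?_ ?_ 1 rfl
    · simpa using hdom r hr
    · simp [Fin.forall_fin_two]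
  | @cons a b u hab p ih =>
    refine .step ![v, b] 1 (Or.inr (by simpa using hab)) (by simp [Fin.forall_fin_two]) ?_
    intro s hs
    have hs' : s ∈ C ∨ s = v ∨ G.Adj v s := by
      rcases hs with rfl | hs
      · exact Or.inl hr
      · exact hclosed r hr s hs
    rcases hs' with hs' | hs'
    · exact ih hdom hs'
    · refine .stepCatch ![s, b] 0 (by simpa using hs') ?_ 0 rfl
      simp [Fin.forall_fin_two]

/-- In a set `W` of at most three vertices, every vertex `r` lies in a subset `C` that is dominated
by a single vertex and is not joined to the rest of `W`. -/
theorem exists_dominated_closed_subset (G : SimpleGraph V) {W : Finset V} (hW : W.card ≤ 3)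
    {r : V} (hr : r ∈ W) :
    ∃ (u : V) (C : Set V), r ∈ C ∧ (∀ x ∈ C, x = u ∨ G.Adj u x) ∧
      ∀ x ∈ C, ∀ y ∈ W, G.Adj x y → y ∈ C := by
  classical
  by_cases hu : ∃ u, ∀ x ∈ W, x = u ∨ G.Adj u x
  · obtain ⟨u, hu⟩ := hu
    exact ⟨u, W, hr, hu, fun _ _ y hy _ => hy⟩
  · refine ⟨r, {x | x ∈ W ∧ (x = r ∨ G.Adj r x)}, ⟨hr, Or.inl rfl⟩, fun x hx => hx.2, ?_⟩
    rintro x ⟨hxW, hx⟩ y hyW hxy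
    refine ⟨hyW, ?_⟩
    by_contra! hy
    have hxr : x ≠ r := by
      rintro rfl
      exact hy.2 hxy
    have hrx : G.Adj r x := hx.resolve_left hxr
    have hsub : ({r, x, y} : Finset V) ⊆ W := by
      simp [Finset.insert_subset_iff, hr, hxW, hyW]
    have hcard : ({r, x, y} : Finset V).card = 3 :=
      Finset.card_eq_three.mpr ⟨r, x, y, hxr.symm, hy.1.symm, hxy.ne, rfl⟩
    have hWeq := Finset.eq_of_subset_of_card_le hsub (hcard ▸ hW)
    refine hu ⟨x, fun z hz => ?_⟩
    rw [← hWeq] at hz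
    simp only [Finset.mem_insert, Finset.mem_singleton] at hz
    rcases hz with rfl | rfl | rfl
    · exact Or.inr hrx.symm
    · exact Or.inl rfl
    · exact Or.inr hxy

/-- a finite connected simple graph on `n` vertices with
`Δ(G) ≥ n - 4` has `c_L(G) ≤ 2`. -/
theorem lazyCopNumber_le_two_of_maxDegree_ge
    {V : Type*} [Fintype V] (G : SimpleGraph V) [DecidableRel G.Adj]
    (hconn : G.Connected) (hΔ : Fintype.card V - 4 ≤ G.maxDegree) :
    lazyCopNumber G ≤ 2 := by
  classical
  have := hconn.nonempty
  obtain ⟨v, hv⟩ := G.exists_maximal_degree_vertex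
  let W : Finset V := (insert v (G.neighborFinset v))ᶜ
  have hmem (x : V) : x ∈ W ↔ ¬ (x = v ∨ G.Adj v x) := by simp [W]
  have hW : W.card ≤ 3 := by
    have hcard : (insert v (G.neighborFinset v)).card = G.degree v + 1 := by
      rw [Finset.card_insert_of_notMem (by simp), G.card_neighborFinset_eq_degree]
    rw [Finset.card_compl, hcard]
    omega
  refine Nat.sInf_le (show LazyCopsWin G 2 from ⟨![v, v], fun r => ?_⟩)
  by_cases hr : r = v ∨ G.Adj v r
  · exact .stepCatch ![r, v] 0 (by simpa using hr) (by simp [Fin.forall_fin_two]) 0 rfl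
  · obtain ⟨u, C, hrC, hdom, hclosed⟩ := exists_dominated_closed_subset G hW ((hmem r).mpr hr)
    obtain ⟨p⟩ := hconn.preconnected v u
    refine lazyWinFrom_of_walk hdom (fun x hx y hxy => ?_) p hrC
    by_cases hy : y = v ∨ G.Adj v y
    · exact Or.inr hy
    · exact Or.inl (hclosed x hx y ((hmem y).mpr hy) hxy)

end CopsRobbers
end

section
/- If G is a finite connected simple graph on n ≤ 8 vertices with maximum degree Δ(G) = 3, then c_L(G) ≤ 2. -/
/-!
Cops and robbers on a simple graph `G`.

A *configuration* consists of the positions of the `k` cops (a function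
`Fin k → V`) together with the robber's position, with the cops to move.
The cops win if at some point a cop occupies the robber's vertex.
-/

namespace CopsRobbers

variable {V : Type*}

section Strategy

variable {V : Type*} {G : SimpleGraph V} {u x r : V}

lemma LazyWinFrom.of_guard (h : r = u ∨ G.Adj u r) : LazyWinFrom G ![u, x] r := by
  rcases h with rfl | h
  · exact .caught 0 rfl
  · refine .stepCatch ![r, x] 0 (Or.inr h) (fun i hi => ?_) 0 rfl
    fin_cases i
    · exact absurd rfl hi
    · rfl

lemma LazyWinFrom.of_chaser (h : r = x ∨ G.Adj x r) : LazyWinFrom G ![u, x] r := by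
  rcases h with rfl | h
  · exact .caught 1 rfl
  · refine .stepCatch ![u, r] 1 (Or.inr h) (fun i hi => ?_) 1 rfl
    fin_cases i
    · rfl
    · exact absurd rfl hi

lemma LazyWinFrom.move_chaser {y : V} (h : y = x ∨ G.Adj x y)
    (hnext : ∀ r', (r' = r ∨ G.Adj r r') → LazyWinFrom G ![u, y] r') :
    LazyWinFrom G ![u, x] r := by
  refine .step ![u, y] 1 h (fun i hi => ?_) hnext
  fin_cases i
  · rfl
  · exact absurd rfl hi

/-- One cop guards `u`, so that the robber cannot leave `T`; the other walks to `d`, from where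
every vertex of `T` is caught in at most two moves. -/
lemma LazyWinFrom.of_confined (hconn : G.Connected) (T : Set V) (d : V)
    (hT : ∀ s ∈ T, ∀ s', G.Adj s s' → s' ∈ T ∨ s' = u ∨ G.Adj u s')
    (hd : ∀ s ∈ T, (s = d ∨ G.Adj d s) ∨ ∃ c, (c = d ∨ G.Adj d c) ∧
      ∀ s' ∈ T, (s' = s ∨ G.Adj s s') → (s' = c ∨ G.Adj c s'))
    (hr : r ∈ T) : LazyWinFrom G ![u, x] r := by
  have confined : ∀ s ∈ T, ∀ s', (s' = s ∨ G.Adj s s') → s' ∈ T ∨ s' = u ∨ G.Adj u s' := by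
    rintro s hs s' (rfl | h)
    · exact Or.inl hs
    · exact hT s hs s' h
  obtain ⟨p⟩ := hconn.preconnected x d
  induction p generalizing r with
  | nil =>
    rcases hd r hr with h | ⟨c, hc, h⟩
    · exact .of_chaser h
    · refine .move_chaser hc fun r' hr' => ?_
      rcases confined r hr r' hr' with h' | h'
      · exact .of_chaser (h r' h' hr')
      · exact .of_guard h'
  | cons hadj _ ih =>
    refine .move_chaser (Or.inr hadj) fun r' hr' => ?_
    rcases confined r hr r' hr' with h' | h'
    · exact ih hd h'
    · exact .of_guard h'

end Strategy

/-- The reflexive symmetric relation on `Fin 4` with the prescribed off-diagonal values. -/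
def fourRel (a b c d e f : Bool) : Fin 4 → Fin 4 → Bool :=
  ![![true, a, b, c], ![a, true, d, e], ![b, d, true, f], ![c, e, f, true]]

set_option synthInstance.maxSize 4000 in
lemma fourRel_dichotomy : ∀ a b c d e f : Bool,
    (∀ s : Fin 4, ∃ p q t : Fin 4, fourRel a b c d e f s p ∧ fourRel a b c d e f s q ∧
      fourRel a b c d e f t p ∧ fourRel a b c d e f t q ∧
      ¬ fourRel a b c d e f s t ∧ ¬ fourRel a b c d e f p q) ∨
    ∀ r : Fin 4, ∃ t₀ t₁ t₂ t₃ : Bool, ![t₀, t₁, t₂, t₃] r ∧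
      (∀ s s' : Fin 4, ![t₀, t₁, t₂, t₃] s → fourRel a b c d e f s s' → ![t₀, t₁, t₂, t₃] s') ∧
      ∃ m : Fin 4, ∀ s : Fin 4, ![t₀, t₁, t₂, t₃] s → fourRel a b c d e f m s ∨
        ∃ k : Fin 4, fourRel a b c d e f m k ∧
          ∀ s' : Fin 4, ![t₀, t₁, t₂, t₃] s' → fourRel a b c d e f s s' → fourRel a b c d e f k s' := by
  decide +kernel

/-- A reflexive symmetric relation on four points is a 4-cycle, or each of its points lies in a
union of components where one chaser wins from a suitable start in at most two moves. -/
lemma four_dichotomy (R : Fin 4 → Fin 4 → Prop) (hrefl : ∀ i, R i i)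
    (hsymm : ∀ i j, R i j → R j i) :
    (∀ s, ∃ p q t, R s p ∧ R s q ∧ R t p ∧ R t q ∧ ¬ R s t ∧ ¬ R p q) ∨
    ∀ r, ∃ T : Set (Fin 4), r ∈ T ∧ (∀ s s', s ∈ T → R s s' → s' ∈ T) ∧
      ∃ m, ∀ s ∈ T, R m s ∨ ∃ k, R m k ∧ ∀ s' ∈ T, R s s' → R k s' := by
  classical
  have key : ∀ i j, fourRel (decide (R 0 1)) (decide (R 0 2)) (decide (R 0 3)) (decide (R 1 2))
      (decide (R 1 3)) (decide (R 2 3)) i j ↔ R i j := by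
    have sw : ∀ i j, R i j ↔ R j i := fun i j => ⟨hsymm i j, hsymm j i⟩
    intro i j
    fin_cases i <;> fin_cases j <;> simp [fourRel, hrefl] <;> exact sw _ _
  have h := fourRel_dichotomy (decide (R 0 1)) (decide (R 0 2)) (decide (R 0 3))
    (decide (R 1 2)) (decide (R 1 3)) (decide (R 2 3))
  simp only [key] at h
  refine h.imp_right fun h r => ?_
  obtain ⟨t₀, t₁, t₂, t₃, hr, hT, m, hm⟩ := h r
  exact ⟨{s | ![t₀, t₁, t₂, t₃] s}, hr, hT, m, hm⟩

/-- If at most four vertices lie outside the closed neighbourhood of `u` and two lazy cops do not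
win, then these vertices induce a 4-cycle. -/
lemma exists_square_of_not_lazyCopsWin {V : Type*} [Finite V] {G : SimpleGraph V}
    (hconn : G.Connected) (hwin : ¬ LazyCopsWin G 2) {u : V}
    (hu : {v | v ≠ u ∧ ¬ G.Adj u v}.ncard ≤ 4) :
    {v | v ≠ u ∧ ¬ G.Adj u v}.Nonempty ∧
    ∀ s, (s ≠ u ∧ ¬ G.Adj u s) → ∃ p q t, (p ≠ u ∧ ¬ G.Adj u p) ∧ (q ≠ u ∧ ¬ G.Adj u q) ∧
      (t ≠ u ∧ ¬ G.Adj u t) ∧ G.Adj s p ∧ G.Adj s q ∧ G.Adj t p ∧ G.Adj t q ∧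
      s ≠ t ∧ ¬ G.Adj s t ∧ p ≠ q := by
  classical
  set S : Set V := {v | v ≠ u ∧ ¬ G.Adj u v} with hS
  have guarded : ∀ v, v ∉ S → v = u ∨ G.Adj u v := by
    intro v hv
    by_contra! h
    exact hv h
  have hne : S.Nonempty := by
    by_contra! h
    exact hwin ⟨![u, u], fun r => .of_guard (guarded r (by simp [h]))⟩
  refine ⟨hne, ?_⟩
  have : Nonempty S := hne.to_subtype
  have := Fintype.ofFinite S
  obtain ⟨g, hg⟩ : ∃ g : Fin 4 → S, Function.Surjective g := by
    obtain ⟨e⟩ : Nonempty (S ↪ Fin 4) := by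
      rw [Function.Embedding.nonempty_iff_card_le]
      rw [← Nat.card_coe_set_eq, Nat.card_eq_fintype_card] at hu
      simpa using hu
    exact ⟨Function.invFun e, Function.invFun_surjective e.injective⟩
  let N : V → V → Prop := fun v w => w = v ∨ G.Adj v w
  have hN : ∀ v w, N v w → N w v := fun v w h => h.imp Eq.symm fun h => h.symm
  rcases four_dichotomy (fun i j => N (g i) (g j)) (fun i => Or.inl rfl)
    (fun i j => hN _ _) with h | h
  · intro s hs
    obtain ⟨i, hi⟩ := hg ⟨s, hs⟩
    obtain ⟨p, q, t, h₁, h₂, h₃, h₄, h₅, h₆⟩ := h i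
    simp only [hi] at h₁ h₂ h₃ h₄ h₅ h₆
    have adj : ∀ {v w}, N v w → v ≠ w → G.Adj v w := fun h hvw => h.resolve_left (Ne.symm hvw)
    refine ⟨g p, g q, g t, (g p).2, (g q).2, (g t).2, adj h₁ ?_, adj h₂ ?_, adj h₃ ?_,
      adj h₄ ?_, ?_, ?_, ?_⟩
    · intro e; exact h₆ (e ▸ h₂)
    · intro e; exact h₆ (hN _ _ (e ▸ h₁))
    · intro e; exact h₅ (e ▸ h₁)
    · intro e; exact h₅ (e ▸ h₂)
    · intro e; exact h₅ (Or.inl e.symm)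
    · intro e; exact h₅ (Or.inr e)
    · intro e; exact h₆ (Or.inl e.symm)
  · refine absurd ⟨![u, u], fun r => ?_⟩ hwin
    by_cases hr : r ∈ S
    · obtain ⟨i, hi⟩ := hg ⟨r, hr⟩
      obtain ⟨T, hiT, hT, m, hm⟩ := h i
      refine .of_confined hconn ((fun j => (g j : V)) '' T) (g m) ?_ ?_ ⟨i, hiT, by simp [hi]⟩
      · rintro _ ⟨j, hj, rfl⟩ s' hs'
        by_cases hs : s' ∈ S
        · obtain ⟨k, hk⟩ := hg ⟨s', hs⟩
          exact Or.inl ⟨k, hT j k hj (Or.inr (by simpa [hk] using hs')), by simp [hk]⟩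
        · exact Or.inr (guarded s' hs)
      · rintro _ ⟨j, hj, rfl⟩
        refine (hm j hj).imp_right ?_
        rintro ⟨k, hk, h'⟩
        refine ⟨g k, hk, ?_⟩
        rintro _ ⟨l, hl, rfl⟩ hjl
        exact h' l hl hjl
    · exact .of_guard (guarded r hr)

/-- a finite connected simple graph on at most 8 vertices with
maximum degree 3 has `c_L(G) ≤ 2`. -/
theorem lazyCopNumber_le_two_of_card_le_eight_maxDegree_three
    {V : Type*} [Fintype V] (G : SimpleGraph V) [DecidableRel G.Adj]
    (hconn : G.Connected) (hcard : Fintype.card V ≤ 8)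
    (hΔ : G.maxDegree = 3) :
    lazyCopNumber G ≤ 2 := by
  classical
  refine Nat.sInf_le ?_
  by_contra hwin
  replace hwin : ¬ LazyCopsWin G 2 := hwin
  have outside : ∀ u, 3 ≤ G.degree u → {v | v ≠ u ∧ ¬ G.Adj u v}.ncard ≤ 4 := by
    intro u hu
    have hset : {v | v ≠ u ∧ ¬ G.Adj u v} = ↑((insert u (G.neighborFinset u))ᶜ) := by
      ext v
      simp [and_comm]
    rw [hset, Set.ncard_coe_finset, Finset.card_compl, Finset.card_insert_of_notMem (by simp),
      G.card_neighborFinset_eq_degree]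
    omega
  have : Nonempty V := hconn.nonempty
  obtain ⟨u, hu⟩ := G.exists_maximal_degree_vertex
  obtain ⟨⟨s, hs⟩, hsq⟩ := exists_square_of_not_lazyCopsWin hconn hwin (outside u (by omega))
  obtain ⟨p⟩ := hconn.preconnected s u
  obtain ⟨e, -, hh, ha⟩ := p.exists_boundary_dart {v | v ≠ u ∧ ¬ G.Adj u v} hs (by simp)
  obtain ⟨p, q, t, hp, hq, -, hhp, hhq, htp, htq, hht, hnht, hpq⟩ := hsq e.fst hh
  have hdeg : 3 ≤ G.degree e.fst := by
    rw [← G.card_neighborFinset_eq_degree, ← Finset.card_eq_three.2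
      ⟨p, q, e.snd, hpq, fun h => ha (h ▸ hp), fun h => ha (h ▸ hq), rfl⟩]
    refine Finset.card_le_card fun v hv => ?_
    simp only [Finset.mem_insert, Finset.mem_singleton] at hv
    rcases hv with rfl | rfl | rfl
    · simpa
    · simpa
    · simp
  obtain ⟨-, hsq'⟩ := exists_square_of_not_lazyCopsWin hconn hwin (outside _ hdeg)
  obtain ⟨p', q', -, hp', hq', -, htp', htq', -, -, -, -, hpq'⟩ := hsq' t ⟨hht.symm, hnht⟩
  have hcard4 : ({p, q, p', q'} : Finset V).card = 4 := by
    have ne : ∀ v w, G.Adj e.fst v → ¬ G.Adj e.fst w → v ≠ w := fun v w hv hw h => hw (h ▸ hv)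
    simp [hpq, hpq', ne p p' hhp hp'.2, ne p q' hhp hq'.2, ne q p' hhq hp'.2, ne q q' hhq hq'.2]
  have hle : ({p, q, p', q'} : Finset V).card ≤ G.degree t := by
    rw [← G.card_neighborFinset_eq_degree]
    refine Finset.card_le_card fun v hv => ?_
    simp only [Finset.mem_insert, Finset.mem_singleton] at hv
    rcases hv with rfl | rfl | rfl | rfl <;> simpa
  have := G.degree_le_maxDegree t
  omega

end CopsRobbers
end

section
/- Let G be a finite connected simple graph on 9 vertices with maximum degree Δ(G) = 4, let u be a vertex with deg(u) = 4, and let H be the induced subgraph on the vertices outside the closed neighborhood N̄(u). Suppose H is a 4-cycle and every vertex of H has exactly two neighbors outside H (i.e., in N(u)). Then either c_L(G) ≤ 2 or G is isomorphic to K_3 □ K_3. -/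
/-!
Cops and robbers on a simple graph `G`.

A *configuration* consists of the positions of the `k` cops (a function
`Fin k → V`) together with the robber's position, with the cops to move.
The cops win if at some point a cop occupies the robber's vertex.
-/

namespace CopsRobbers

variable {V : Type*}

section TwoLazyCops

variable {G : SimpleGraph V}

/-- Two cops at `p` and `q` catch a robber standing in the union of their closed
neighborhoods. -/
theorem LazyWinFrom.of_dominated {p q r : V}
    (h : r = p ∨ r = q ∨ G.Adj p r ∨ G.Adj q r) : LazyWinFrom G ![p, q] r := by
  rcases h with rfl | rfl | h | h
  · exact .caught 0 rfl
  · exact .caught 1 rfl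
  · exact .stepCatch ![r, q] 0 (Or.inr h) (by simp [Fin.forall_fin_two]) 0 rfl
  · exact .stepCatch ![p, r] 1 (Or.inr h) (by simp [Fin.forall_fin_two]) 1 rfl

theorem LazyWinFrom.move_fst {p q r : V} (p' : V) (hp : G.Adj p p')
    (h : ∀ r', (r' = r ∨ G.Adj r r') → LazyWinFrom G ![p', q] r') :
    LazyWinFrom G ![p, q] r :=
  .step ![p', q] 0 (Or.inr hp) (by simp [Fin.forall_fin_two]) h

theorem LazyWinFrom.move_snd {p q r : V} (q' : V) (hq : G.Adj q q')
    (h : ∀ r', (r' = r ∨ G.Adj r r') → LazyWinFrom G ![p, q'] r') :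
    LazyWinFrom G ![p, q] r :=
  .step ![p, q'] 1 (Or.inr hq) (by simp [Fin.forall_fin_two]) h

/-- The vertices outside the closed neighborhood of `u` are `p`, `q`, `r`, `s`, and they
induce the 4-cycle `p q r s`. -/
structure IsOuterFourCycle (G : SimpleGraph V) (u p q r s : V) : Prop where
  cover : ∀ v, v = u ∨ G.Adj u v ∨ v = p ∨ v = q ∨ v = r ∨ v = s
  ne_p : p ≠ u
  ne_q : q ≠ u
  ne_r : r ≠ u
  ne_s : s ≠ u
  not_adj_p : ¬ G.Adj u p
  not_adj_q : ¬ G.Adj u q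
  not_adj_r : ¬ G.Adj u r
  not_adj_s : ¬ G.Adj u s
  pq : G.Adj p q
  qr : G.Adj q r
  rs : G.Adj r s
  sp : G.Adj s p
  ne_pr : p ≠ r
  ne_qs : q ≠ s
  not_pr : ¬ G.Adj p r
  not_qs : ¬ G.Adj q s

/-- `x` and `y` are the neighbors of `p` in the neighborhood of `u`. -/
structure IsInnerPair (G : SimpleGraph V) (u p x y : V) : Prop where
  ne : x ≠ y
  adj_fst : G.Adj u x
  adj_snd : G.Adj u y
  adj_iff : ∀ z, G.Adj u z → (G.Adj p z ↔ z = x ∨ z = y)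

namespace IsInnerPair

variable {u p x y : V}

theorem symm (P : IsInnerPair G u p x y) : IsInnerPair G u p y x :=
  ⟨P.ne.symm, P.adj_snd, P.adj_fst, fun z hz => (P.adj_iff z hz).trans or_comm⟩

theorem adj_left (P : IsInnerPair G u p x y) : G.Adj p x :=
  (P.adj_iff x P.adj_fst).2 (Or.inl rfl)

theorem adj_right (P : IsInnerPair G u p x y) : G.Adj p y :=
  (P.adj_iff y P.adj_snd).2 (Or.inr rfl)

end IsInnerPair

namespace IsOuterFourCycle

variable {u p q r s : V}

theorem rotate (C : IsOuterFourCycle G u p q r s) : IsOuterFourCycle G u q r s p where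
  cover v := by have := C.cover v; tauto
  ne_p := C.ne_q
  ne_q := C.ne_r
  ne_r := C.ne_s
  ne_s := C.ne_p
  not_adj_p := C.not_adj_q
  not_adj_q := C.not_adj_r
  not_adj_r := C.not_adj_s
  not_adj_s := C.not_adj_p
  pq := C.qr
  qr := C.rs
  rs := C.sp
  sp := C.pq
  ne_pr := C.ne_qs
  ne_qs := C.ne_pr.symm
  not_pr := C.not_qs
  not_qs h := C.not_pr h.symm

theorem reflect (C : IsOuterFourCycle G u p q r s) : IsOuterFourCycle G u p s r q where
  cover v := by have := C.cover v; tauto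
  ne_p := C.ne_p
  ne_q := C.ne_s
  ne_r := C.ne_r
  ne_s := C.ne_q
  not_adj_p := C.not_adj_p
  not_adj_q := C.not_adj_s
  not_adj_r := C.not_adj_r
  not_adj_s := C.not_adj_q
  pq := C.sp.symm
  qr := C.rs.symm
  rs := C.qr.symm
  sp := C.pq.symm
  ne_pr := C.ne_pr
  ne_qs := C.ne_qs.symm
  not_pr := C.not_pr
  not_qs h := C.not_qs h.symm

/-- With cops at `u` and `r` the robber has to start at `p`; moving the cop from `u` to `x`
then forces him to `y`. -/
theorem lazyCopsWin_of_win_at (C : IsOuterFourCycle G u p q r s) {x y : V}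
    (P : IsInnerPair G u p x y) (h : LazyWinFrom G ![x, r] y) : LazyCopsWin G 2 := by
  refine ⟨![u, r], fun v => ?_⟩
  rcases C.cover v with rfl | hv | rfl | rfl | rfl | rfl
  · exact .of_dominated (by tauto)
  · exact .of_dominated (by tauto)
  · refine .move_fst x P.adj_fst fun v' hv' => ?_
    rcases hv' with rfl | hv'
    · exact .of_dominated (Or.inr (Or.inr (Or.inl P.adj_left.symm)))
    rcases C.cover v' with rfl | hu | rfl | rfl | rfl | rfl
    · exact .of_dominated (Or.inr (Or.inr (Or.inl P.adj_fst.symm)))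
    · rcases (P.adj_iff v' hu).1 hv' with rfl | rfl
      · exact .of_dominated (Or.inl rfl)
      · exact h
    · exact (hv'.ne rfl).elim
    · exact .of_dominated (Or.inr (Or.inr (Or.inr C.qr.symm)))
    · exact .of_dominated (Or.inr (Or.inl rfl))
    · exact .of_dominated (Or.inr (Or.inr (Or.inr C.rs)))
  · exact .of_dominated (Or.inr (Or.inr (Or.inr C.qr.symm)))
  · exact .of_dominated (Or.inr (Or.inl rfl))
  · exact .of_dominated (Or.inr (Or.inr (Or.inr C.rs)))

theorem not_adj_inner (C : IsOuterFourCycle G u p q r s) (hG : ¬ LazyCopsWin G 2) {x y : V}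
    (P : IsInnerPair G u p x y) : ¬ G.Adj x y := fun h =>
  hG (C.lazyCopsWin_of_win_at P (.of_dominated (Or.inr (Or.inr (Or.inl h)))))

theorem not_adj_opposite (C : IsOuterFourCycle G u p q r s) (hG : ¬ LazyCopsWin G 2) {x y : V}
    (P : IsInnerPair G u p x y) : ¬ G.Adj r y := fun h =>
  hG (C.lazyCopsWin_of_win_at P (.of_dominated (Or.inr (Or.inr (Or.inr h)))))

/-- If two cops do not win, the inner pairs of opposite vertices of the outer cycle exhaust
the neighborhood of `u`. -/
theorem adj_iff_of_degree_eq_four [Fintype V] [DecidableRel G.Adj] [DecidableEq V]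
    (C : IsOuterFourCycle G u p q r s) (hG : ¬ LazyCopsWin G 2)
    (hu : G.degree u = 4) {a b c d : V} (P : IsInnerPair G u p a b) (R : IsInnerPair G u r c d)
    (z : V) : G.Adj u z ↔ z = a ∨ z = b ∨ z = c ∨ z = d := by
  have hb := C.not_adj_opposite hG P
  have ha := C.not_adj_opposite hG P.symm
  have hac : a ≠ c := by rintro rfl; exact ha R.adj_left
  have had : a ≠ d := by rintro rfl; exact ha R.adj_right
  have hbc : b ≠ c := by rintro rfl; exact hb R.adj_left
  have hbd : b ≠ d := by rintro rfl; exact hb R.adj_right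
  have hsub : ({a, b, c, d} : Finset V) ⊆ G.neighborFinset u := by
    intro v hv
    simp only [Finset.mem_insert, Finset.mem_singleton] at hv
    rw [SimpleGraph.mem_neighborFinset]
    rcases hv with rfl | rfl | rfl | rfl
    exacts [P.adj_fst, P.adj_snd, R.adj_fst, R.adj_snd]
  have hcard : ({a, b, c, d} : Finset V).card = 4 := by
    simp [*, P.ne, R.ne]
  have heq := Finset.eq_of_subset_of_card_le hsub
    (by rw [SimpleGraph.card_neighborFinset_eq_degree, hu, hcard])
  rw [← SimpleGraph.mem_neighborFinset, ← heq]
  simp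

/-- The cops win if the two vertices `p`, `q` of an edge of the cycle have the same inner pair. -/
theorem lazyCopsWin_of_parallel [Fintype V] [DecidableRel G.Adj] [DecidableEq V]
    (C : IsOuterFourCycle G u p q r s) (hΔ : ∀ v, G.degree v ≤ 4) (hu : G.degree u = 4)
    {a b c d : V} (P : IsInnerPair G u p a b) (Q : IsInnerPair G u q a b)
    (R : IsInnerPair G u r c d) : LazyCopsWin G 2 := by
  by_contra hG
  have hN := C.adj_iff_of_degree_eq_four hG hu P R
  have hab := C.not_adj_inner hG P
  have hrb := C.not_adj_opposite hG P
  have hsb := C.rotate.not_adj_opposite hG Q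
  have hbcd : ¬ (G.Adj b c ∧ G.Adj b d) := by
    rintro ⟨hc, hd⟩
    have hsub : ({u, p, q, c, d} : Finset V) ⊆ G.neighborFinset b := by
      intro v hv
      simp only [Finset.mem_insert, Finset.mem_singleton] at hv
      rw [SimpleGraph.mem_neighborFinset]
      rcases hv with rfl | rfl | rfl | rfl | rfl
      exacts [P.adj_snd.symm, P.adj_right.symm, Q.adj_right.symm, hc, hd]
    have hpc : p ≠ c := by rintro rfl; exact C.not_adj_p R.adj_fst
    have hpd : p ≠ d := by rintro rfl; exact C.not_adj_p R.adj_snd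
    have hqc : q ≠ c := by rintro rfl; exact C.not_adj_q R.adj_fst
    have hqd : q ≠ d := by rintro rfl; exact C.not_adj_q R.adj_snd
    have hcard : ({u, p, q, c, d} : Finset V).card = 5 := by
      simp [*, C.ne_p.symm, C.ne_q.symm, C.pq.ne, R.adj_fst.ne, R.adj_snd.ne, R.ne]
    have := Finset.card_le_card hsub
    rw [SimpleGraph.card_neighborFinset_eq_degree, hcard] at this
    have := hΔ b
    omega
  have hnbr : ∀ v, G.Adj b v → v = u ∨ v = p ∨ v = q ∨ v = c ∨ v = d := by
    intro v hv
    rcases C.cover v with rfl | h | rfl | rfl | rfl | rfl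
    · tauto
    · rcases (hN v).1 h with rfl | rfl | rfl | rfl
      · exact (hab hv.symm).elim
      · exact (hv.ne rfl).elim
      · tauto
      · tauto
    · tauto
    · tauto
    · exact (hrb hv.symm).elim
    · exact (hsb hv.symm).elim
  have hua := P.adj_fst.symm
  have hpa := P.adj_left.symm
  have hqa := Q.adj_left.symm
  refine hG (C.lazyCopsWin_of_win_at P ?_)
  by_cases hc : G.Adj b c
  · refine .move_snd c R.adj_left fun v hv => .of_dominated ?_
    rcases hv with rfl | hv
    · exact Or.inr (Or.inr (Or.inr hc.symm))
    rcases hnbr v hv with rfl | rfl | rfl | rfl | rfl <;> tauto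
  by_cases hd : G.Adj b d
  · refine .move_snd d R.adj_right fun v hv => .of_dominated ?_
    rcases hv with rfl | hv
    · exact Or.inr (Or.inr (Or.inr hd.symm))
    rcases hnbr v hv with rfl | rfl | rfl | rfl | rfl <;> tauto
  refine .move_snd q C.qr.symm fun v hv => .of_dominated ?_
  rcases hv with rfl | hv
  · exact Or.inr (Or.inr (Or.inr Q.adj_right))
  rcases hnbr v hv with rfl | rfl | rfl | rfl | rfl <;> tauto

/-- If the inner pairs cross, two cops win unless `a` and `d` are adjacent. -/
theorem adj_of_crossing [Fintype V] [DecidableRel G.Adj] [DecidableEq V]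
    (C : IsOuterFourCycle G u p q r s) (hG : ¬ LazyCopsWin G 2) (hu : G.degree u = 4)
    {a b c d : V} (P : IsInnerPair G u p a b) (Q : IsInnerPair G u q a c)
    (R : IsInnerPair G u r c d) : G.Adj a d := by
  by_contra had
  have hN := C.adj_iff_of_degree_eq_four hG hu P R
  refine hG (C.lazyCopsWin_of_win_at P.symm ?_)
  refine .move_snd q C.qr.symm fun v hv => .of_dominated ?_
  rcases hv with rfl | hv
  · exact Or.inr (Or.inr (Or.inr Q.adj_left))
  rcases C.cover v with rfl | h | rfl | rfl | rfl | rfl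
  · exact Or.inr (Or.inr (Or.inl P.adj_snd.symm))
  · rcases (hN v).1 h with rfl | rfl | rfl | rfl
    · exact (hv.ne rfl).elim
    · exact Or.inl rfl
    · exact (C.rotate.not_adj_inner hG Q hv).elim
    · exact (had hv).elim
  · exact Or.inr (Or.inr (Or.inl P.adj_right.symm))
  · exact Or.inr (Or.inl rfl)
  · exact (C.not_adj_opposite hG P.symm hv.symm).elim
  · exact (C.rotate.not_adj_opposite hG Q.symm hv.symm).elim

/-- If the inner pairs of `p`, `q`, `r` cross, they determine that of `s`. -/
theorem innerPair_of_crossing [Fintype V] [DecidableRel G.Adj] [DecidableEq V]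
    (C : IsOuterFourCycle G u p q r s) (hG : ¬ LazyCopsWin G 2) (hu : G.degree u = 4)
    {a b c d x y : V} (P : IsInnerPair G u p a b) (Q : IsInnerPair G u q a c)
    (R : IsInnerPair G u r c d) (S : IsInnerPair G u s x y) : IsInnerPair G u s b d := by
  have hN := C.adj_iff_of_degree_eq_four hG hu P R
  have hM := C.rotate.adj_iff_of_degree_eq_four hG hu Q S
  have hrb := C.not_adj_opposite hG P
  have hpd := C.rotate.rotate.not_adj_opposite hG R
  have hsa := C.rotate.not_adj_opposite hG Q.symm
  have hsc := C.rotate.not_adj_opposite hG Q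
  have hbc : b ≠ c := by rintro rfl; exact hrb R.adj_left
  have hbd : b ≠ d := by rintro rfl; exact hrb R.adj_right
  have hda : d ≠ a := by rintro rfl; exact hpd P.adj_left
  have hsb : G.Adj s b := by
    have := (hM b).1 P.adj_snd
    exact (S.adj_iff b P.adj_snd).2 (by have := P.ne.symm; tauto)
  have hsd : G.Adj s d := by
    have := (hM d).1 R.adj_snd
    exact (S.adj_iff d R.adj_snd).2 (by have := R.ne.symm; tauto)
  refine ⟨hbd, P.adj_snd, R.adj_snd, fun z hz => ⟨fun h => ?_, ?_⟩⟩
  · rcases (hN z).1 hz with rfl | rfl | rfl | rfl <;> tauto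
  · rintro (rfl | rfl) <;> assumption

/-- If the inner pairs cross and two cops do not win, the graph is the `3 × 3` rooks graph. -/
theorem iso_rooksGraph_of_crossing [Fintype V] [DecidableRel G.Adj] [DecidableEq V]
    (C : IsOuterFourCycle G u p q r s) (hG : ¬ LazyCopsWin G 2) (hu : G.degree u = 4)
    (hV : Fintype.card V = 9)
    {a b c d x y : V} (P : IsInnerPair G u p a b) (Q : IsInnerPair G u q a c)
    (R : IsInnerPair G u r c d) (S' : IsInnerPair G u s x y) :
    Nonempty (G ≃g rooksGraph 3) := by
  have S := C.innerPair_of_crossing hG hu P Q R S'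
  have had := C.adj_of_crossing hG hu P Q R
  have hbc := C.reflect.adj_of_crossing hG hu P.symm S R.symm
  have hab := C.not_adj_inner hG P
  have hac := C.rotate.not_adj_inner hG Q
  have hcd := C.rotate.rotate.not_adj_inner hG R
  have hbd := C.reflect.rotate.not_adj_inner hG S
  have hra := C.not_adj_opposite hG P.symm
  have hrb := C.not_adj_opposite hG P
  have hsa := C.rotate.not_adj_opposite hG Q.symm
  have hsc := C.rotate.not_adj_opposite hG Q
  have hpc := C.rotate.rotate.not_adj_opposite hG R.symm
  have hpd := C.rotate.rotate.not_adj_opposite hG R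
  have hqb := C.reflect.rotate.not_adj_opposite hG S.symm
  have hqd := C.reflect.rotate.not_adj_opposite hG S
  obtain ⟨-, -, -, -, -, hup, huq, hur, hus, hpq, hqr, hrs, hsp, -, -, hpr, hqs⟩ := C
  have hua := P.adj_fst
  have hub := P.adj_snd
  have huc := R.adj_fst
  have hud := R.adj_snd
  have hpa := P.adj_left
  have hpb := P.adj_right
  have hqa := Q.adj_left
  have hqc := Q.adj_right
  have hrc := R.adj_left
  have hrd := R.adj_right
  have hsb := S.adj_left
  have hsd := S.adj_right
  let f : Fin 3 × Fin 3 → V := fun i => !![u, a, d; b, p, s; c, q, r] i.1 i.2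
  have hf : ∀ i j, G.Adj (f i) (f j) ↔ (rooksGraph 3).Adj i j := by
    rintro ⟨i, i'⟩ ⟨j, j'⟩
    fin_cases i <;> fin_cases i' <;> fin_cases j <;> fin_cases j' <;>
      simp [f, rooksGraph, SimpleGraph.boxProd_adj] <;>
      first | assumption | (rw [G.adj_comm]; assumption)
  have hinj : Function.Injective f := by
    intro i j hij
    have h : ∀ k, (rooksGraph 3).Adj i k ↔ (rooksGraph 3).Adj j k := fun k => by
      rw [← hf, ← hf, hij]
    simp only [rooksGraph, SimpleGraph.boxProd_adj, SimpleGraph.top_adj] at h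
    clear hij
    revert i j
    decide
  have hbij : Function.Bijective f :=
    (Fintype.bijective_iff_injective_and_card f).2 ⟨hinj, by simp [hV]⟩
  exact ⟨(⟨Equiv.ofBijective f hbij, hf _ _⟩ : rooksGraph 3 ≃g G).symm⟩

/-- The inner pairs of a cycle on which two cops do not win force the `3 × 3` rooks graph. -/
theorem iso_rooksGraph [Fintype V] [DecidableRel G.Adj] [DecidableEq V]
    (C : IsOuterFourCycle G u p q r s) (hG : ¬ LazyCopsWin G 2) (hΔ : ∀ v, G.degree v ≤ 4)
    (hu : G.degree u = 4) (hV : Fintype.card V = 9)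
    (hpair : ∀ v, v ≠ u → ¬ G.Adj u v → ∃ x y, IsInnerPair G u v x y) :
    Nonempty (G ≃g rooksGraph 3) := by
  obtain ⟨a, b, P⟩ := hpair p C.ne_p C.not_adj_p
  obtain ⟨x, y, Q⟩ := hpair q C.ne_q C.not_adj_q
  obtain ⟨c, d, R⟩ := hpair r C.ne_r C.not_adj_r
  obtain ⟨z, w, S⟩ := hpair s C.ne_s C.not_adj_s
  have hN := C.adj_iff_of_degree_eq_four hG hu P R
  rcases (hN x).1 Q.adj_fst with rfl | rfl | rfl | rfl <;>
    rcases (hN y).1 Q.adj_snd with rfl | rfl | rfl | rfl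
  · exact (Q.ne rfl).elim
  · exact (hG (C.lazyCopsWin_of_parallel hΔ hu P Q R)).elim
  · exact C.iso_rooksGraph_of_crossing hG hu hV P Q R S
  · exact C.iso_rooksGraph_of_crossing hG hu hV P Q R.symm S
  · exact (hG (C.lazyCopsWin_of_parallel hΔ hu P Q.symm R)).elim
  · exact (Q.ne rfl).elim
  · exact C.iso_rooksGraph_of_crossing hG hu hV P.symm Q R S
  · exact C.iso_rooksGraph_of_crossing hG hu hV P.symm Q R.symm S
  · exact C.iso_rooksGraph_of_crossing hG hu hV P Q.symm R S
  · exact C.iso_rooksGraph_of_crossing hG hu hV P.symm Q.symm R S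
  · exact (Q.ne rfl).elim
  · exact (hG (C.rotate.lazyCopsWin_of_parallel hΔ hu Q R S)).elim
  · exact C.iso_rooksGraph_of_crossing hG hu hV P Q.symm R.symm S
  · exact C.iso_rooksGraph_of_crossing hG hu hV P.symm Q.symm R.symm S
  · exact (hG (C.rotate.lazyCopsWin_of_parallel hΔ hu Q R.symm S)).elim
  · exact (Q.ne rfl).elim

end IsOuterFourCycle

end TwoLazyCops

/-- `G` connected on 9 vertices with `Δ(G) = 4`, `u` a vertex of
degree 4, and the induced subgraph `H` on the complement of the closed
neighborhood of `u` a 4-cycle each of whose vertices has exactly two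
neighbors outside `H` (i.e. in `N(u)`).  Then `c_L(G) ≤ 2` or
`G ≅ K_3 □ K_3`. -/
theorem lazy_le_two_or_iso_rooks3_of_four_cycle_outside
    {V : Type*} [Fintype V] [DecidableEq V] (G : SimpleGraph V)
    [DecidableRel G.Adj] (hconn : G.Connected)
    (hcard : Fintype.card V = 9) (hΔ : G.maxDegree = 4)
    (u : V) (hu : G.degree u = 4)
    (hcycle : Nonempty
      ((G.induce {w : V | w ∉ insert u (G.neighborSet u)}) ≃g
        SimpleGraph.cycleGraph 4))
    (hout : ∀ w : V, w ∉ insert u (G.neighborSet u) →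
      ((G.neighborFinset u).filter (fun x => G.Adj w x)).card = 2) :
    lazyCopNumber G ≤ 2 ∨ Nonempty (G ≃g rooksGraph 3) := by
  by_cases hG : LazyCopsWin G 2
  · exact Or.inl (Nat.sInf_le hG)
  right
  have hmem : ∀ v, v ∉ insert u (G.neighborSet u) ↔ v ≠ u ∧ ¬ G.Adj u v := by simp
  obtain ⟨e⟩ := hcycle
  have hout_e : ∀ i, (e.symm i).1 ≠ u ∧ ¬ G.Adj u (e.symm i).1 := fun i =>
    (hmem _).1 (e.symm i).2
  have hadj : ∀ i j, G.Adj (e.symm i).1 (e.symm j).1 ↔ (SimpleGraph.cycleGraph 4).Adj i j :=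
    fun i j => e.symm.map_adj_iff
  have hinj : ∀ i j, i ≠ j → (e.symm i).1 ≠ (e.symm j).1 := fun i j hij h =>
    hij (e.symm.injective (Subtype.ext h))
  have C : IsOuterFourCycle G u (e.symm 0).1 (e.symm 1).1 (e.symm 2).1 (e.symm 3).1 :=
    { cover := by
        intro v
        by_cases hv : v ≠ u ∧ ¬ G.Adj u v
        · obtain ⟨i, hi⟩ := e.symm.surjective ⟨v, (hmem v).2 hv⟩
          have hi : v = (e.symm i).1 := by rw [hi]
          fin_cases i <;> simp at hi <;> tauto
        · tauto
      ne_p := (hout_e 0).1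
      ne_q := (hout_e 1).1
      ne_r := (hout_e 2).1
      ne_s := (hout_e 3).1
      not_adj_p := (hout_e 0).2
      not_adj_q := (hout_e 1).2
      not_adj_r := (hout_e 2).2
      not_adj_s := (hout_e 3).2
      pq := (hadj 0 1).2 (by decide)
      qr := (hadj 1 2).2 (by decide)
      rs := (hadj 2 3).2 (by decide)
      sp := (hadj 3 0).2 (by decide)
      ne_pr := hinj 0 2 (by decide)
      ne_qs := hinj 1 3 (by decide)
      not_pr := fun h => absurd ((hadj 0 2).1 h) (by decide)
      not_qs := fun h => absurd ((hadj 1 3).1 h) (by decide) }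
  refine C.iso_rooksGraph hG (fun v => hΔ ▸ G.degree_le_maxDegree v) hu hcard fun v hv hv' => ?_
  obtain ⟨x, y, hxy, h⟩ := Finset.card_eq_two.1 (hout v ((hmem v).2 ⟨hv, hv'⟩))
  have h' : ∀ z, (G.Adj u z ∧ G.Adj v z) ↔ z = x ∨ z = y := fun z => by
    simpa using Finset.ext_iff.1 h z
  exact ⟨x, y, hxy, ((h' x).2 (Or.inl rfl)).1, ((h' y).2 (Or.inr rfl)).1,
    fun z hz => ⟨fun hvz => (h' z).1 ⟨hz, hvz⟩, fun hz' => ((h' z).2 hz').2⟩⟩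

end CopsRobbers
end

section
/- If G is a finite connected simple graph on 9 vertices with minimum degree δ(G) ≥ 2, maximum degree Δ(G) ≤ 3, and at most 10 edges, then c_L(G) ≤ 2. -/
/-!
Cops and robbers on a simple graph `G`.

A *configuration* consists of the positions of the `k` cops (a function
`Fin k → V`) together with the robber's position, with the cops to move.
The cops win if at some point a cop occupies the robber's vertex.
-/

namespace CopsRobbers

variable {V : Type*}

theorem LazyWinFrom.update {G : SimpleGraph V} {k : ℕ} {c : Fin k → V} {r x : V} (i : Fin k)
    (hx : G.Adj (c i) x)
    (h : ∀ r', (r' = r ∨ G.Adj r r') → LazyWinFrom G (Function.update c i x) r') :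
    LazyWinFrom G c r :=
  .step (Function.update c i x) i (.inr (by simpa using hx))
    (fun _ hj => Function.update_of_ne hj _ _) h

/-- A cop `i` walks to a cop `j` who confines the robber to `T`. -/
theorem lazyWinFrom_of_walk_s8 {G : SimpleGraph V} {k : ℕ} {i j : Fin k} (hij : i ≠ j)
    {T : Finset V} {b : V} (hT : ∀ x ∈ T, ∀ y, G.Adj x y → y ∈ T ∨ y = b)
    (hwin : ∀ (c : Fin k → V) (r : V), c i = b → c j = b → r ∈ T → LazyWinFrom G c r)
    {a : V} (p : G.Walk a b) (c : Fin k → V) (r : V) (hi : c i = a) (hj : c j = b)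
    (hr : r ∈ T) : LazyWinFrom G c r := by
  induction p generalizing c r with
  | nil => exact hwin c r hi hj hr
  | @cons _ x _ hadj p ih =>
    refine .update i (hi ▸ hadj) fun r' hr' => ?_
    have hj' := (Function.update_of_ne hij.symm x c).trans hj
    rcases hr' with rfl | hr'
    · exact ih hT hwin _ _ (by simp) hj' hr
    · rcases hT r hr r' hr' with h | rfl
      · exact ih hT hwin _ _ (by simp) hj' h
      · exact .caught j hj'

theorem exists_adj_mem_of_connected {G : SimpleGraph V} (hconn : G.Connected) {T : Finset V}
    {r b : V} (hr : r ∈ T) (hb : b ∉ T) : ∃ x ∈ T, ∃ y ∉ T, G.Adj x y := by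
  obtain ⟨p⟩ := hconn.preconnected r b
  obtain ⟨d, -, h₁, h₂⟩ := p.exists_boundary_dart (T : Set V) hr hb
  exact ⟨d.fst, h₁, d.snd, h₂, d.adj⟩

theorem eq_of_adj_of_degree_le_two {G : SimpleGraph V} [Fintype V] [DecidableRel G.Adj]
    {x a y z : V} (hx : G.degree x ≤ 2) (ha : G.Adj x a) (hy : G.Adj x y) (hz : G.Adj x z)
    (hya : y ≠ a) (hza : z ≠ a) : y = z := by
  by_contra hyz
  have : 2 < (G.neighborFinset x).card :=
    Finset.two_lt_card.2 ⟨a, by simpa, y, by simpa, z, by simpa, hya.symm, hza.symm, hyz⟩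
  rw [G.card_neighborFinset_eq_degree] at this
  omega

/-- Two cops guarding a territory of vertices of degree at most two catch the robber in it,
provided they are together or one of them has at most one neighbour in the territory. -/
theorem lazyWinFrom_of_confined {G : SimpleGraph V} [Fintype V] [DecidableEq V]
    [DecidableRel G.Adj] (hconn : G.Connected) {k : ℕ} {i j : Fin k} (hij : i ≠ j)
    (T : Finset V) (hdeg : ∀ x ∈ T, G.degree x ≤ 2) (c : Fin k → V) (r : V)
    (hi : c i ∉ T) (hj : c j ∉ T)
    (hT : ∀ x ∈ T, ∀ y, G.Adj x y → y ∈ T ∨ y = c i ∨ y = c j)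
    (hentry : c i = c j ∨ ∀ x ∈ T, ∀ y ∈ T, G.Adj (c i) x → G.Adj (c i) y → x = y)
    (hr : r ∈ T) : LazyWinFrom G c r := by
  induction T using Finset.strongInduction generalizing c r with
  | H T ih =>
  have advance : ∀ (c : Fin k → V) (r x : V), x ∈ T → c i ∉ T → c j ∉ T → r ∈ T →
      G.Adj (c i) x → (∀ z ∈ T.erase x, ∀ y, G.Adj z y → y ∈ T ∨ y = c j) →
      LazyWinFrom G c r := by
    intro c r x hx hi hj hr hadj hT
    by_cases hrx : r = x
    · exact .stepCatch (Function.update c i x) i (.inr (by simpa using hadj))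
        (fun _ h => Function.update_of_ne h _ _) i (by simp [hrx])
    have hj' : Function.update c i x j = c j := Function.update_of_ne hij.symm _ _
    have hr₀ : r ∈ T.erase x := Finset.mem_erase.2 ⟨hrx, hr⟩
    have win : ∀ r' ∈ T.erase x, LazyWinFrom G (Function.update c i x) r' := by
      intro r' hr'
      refine ih _ (Finset.erase_ssubset hx) (fun z hz => hdeg z (Finset.mem_of_mem_erase hz))
        _ _ (by simp) (by rw [hj']; exact fun h => hj (Finset.mem_of_mem_erase h)) ?_
        (.inr ?_) hr'
      · intro z hz y hzy
        rw [hj', Function.update_self, Finset.mem_erase]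
        have := hT z hz y hzy
        tauto
      · intro y hy z hz hxy hxz
        rw [Function.update_self] at hxy hxz
        exact eq_of_adj_of_degree_le_two (hdeg x hx) hadj.symm hxy hxz
          (fun h => hi (h ▸ Finset.mem_of_mem_erase hy))
          (fun h => hi (h ▸ Finset.mem_of_mem_erase hz))
    refine .update i hadj fun r' hr' => ?_
    rcases hr' with rfl | hr'
    · exact win _ hr₀
    · rcases hT r hr₀ r' hr' with h | rfl
      · by_cases hx' : r' = x
        · exact .caught i (by simp [hx'])
        · exact win _ (Finset.mem_erase.2 ⟨hx', h⟩)
      · exact .caught j hj'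
  have together : ∀ (b : V), b ∉ T → (∀ x ∈ T, ∀ y, G.Adj x y → y ∈ T ∨ y = b) →
      ∀ (c : Fin k → V) (r : V), c i = b → c j = b → r ∈ T → LazyWinFrom G c r := by
    intro b hb hT c r hi hj hr
    obtain ⟨x, hx, y, hy, hxy⟩ := exists_adj_mem_of_connected hconn hr hb
    obtain rfl := (hT x hx y hxy).resolve_left hy
    exact advance c r x hx (hi ▸ hb) (hj ▸ hb) hr (hi ▸ hxy.symm)
      fun z hz w hzw => hj ▸ hT z (Finset.mem_of_mem_erase hz) w hzw
  rcases hentry with heq | hone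
  · exact together (c j) hj (by simpa [heq] using hT) c r heq rfl hr
  by_cases hex : ∃ x ∈ T, G.Adj (c i) x
  · obtain ⟨x, hx, hadj⟩ := hex
    refine advance c r x hx hi hj hr hadj fun z hz y hzy => ?_
    rcases hT z (Finset.mem_of_mem_erase hz) y hzy with h | rfl | h
    · exact .inl h
    · exact absurd (hone z (Finset.mem_of_mem_erase hz) x hx hzy.symm hadj)
        (Finset.ne_of_mem_erase hz)
    · exact .inr h
  · have hT' : ∀ x ∈ T, ∀ y, G.Adj x y → y ∈ T ∨ y = c j := by
      intro x hx y hxy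
      rcases hT x hx y hxy with h | rfl | h
      · exact .inl h
      · exact absurd ⟨x, hx, hxy.symm⟩ hex
      · exact .inr h
    obtain ⟨p⟩ := hconn.preconnected (c i) (c j)
    exact lazyWinFrom_of_walk_s8 hij hT' (together _ hj hT') p c r rfl rfl hr

theorem card_interedges_insert_le_two {G : SimpleGraph V} [Fintype V] [DecidableEq V]
    [DecidableRel G.Adj] {T : Finset V} (hT : (G.interedges T Tᶜ).card ≤ 2) {x y : V}
    (hx : x ∈ T) (hy : y ∉ T) (hxy : G.Adj x y) (hdeg : G.degree y ≤ 2) :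
    (G.interedges (insert y T) (insert y T)ᶜ).card ≤ 2 := by
  have hsub : G.interedges (insert y T) (insert y T)ᶜ ⊆
      (G.interedges T Tᶜ).erase (x, y) ∪
        ((G.neighborFinset y).erase x).image (Prod.mk y) := by
    rintro ⟨z, w⟩ h
    simp only [SimpleGraph.mem_interedges_iff, Finset.mem_insert, Finset.mem_compl, not_or] at h
    simp only [Finset.mem_union, Finset.mem_erase, SimpleGraph.mem_interedges_iff,
      Finset.mem_compl, Finset.mem_image, SimpleGraph.mem_neighborFinset, Prod.mk.injEq, ne_eq]
    obtain ⟨rfl | hz, ⟨hwy, hw⟩, hzw⟩ := h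
    · exact .inr ⟨w, ⟨fun h => hw (h ▸ hx), hzw⟩, rfl, rfl⟩
    · exact .inl ⟨fun h => hwy h.2, hz, hw, hzw⟩
  have h₁ := Finset.card_erase_of_mem (s := G.interedges T Tᶜ) (a := (x, y))
    (by simp [SimpleGraph.mem_interedges_iff, hx, hy, hxy])
  have h₂ := Finset.card_erase_of_mem (s := G.neighborFinset y) (a := x)
    (by simpa using hxy.symm)
  rw [G.card_neighborFinset_eq_degree] at h₂
  have h₃ := (Finset.card_le_card hsub).trans (Finset.card_union_le _ _)
  have h₄ := Finset.card_image_le (s := (G.neighborFinset y).erase x) (f := Prod.mk y)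
  omega

/-- If all vertices outside `S` have degree at most two, then any such vertex lies in a territory
bounded by `S` with at most two edges leaving it. -/
theorem exists_territory {G : SimpleGraph V} [Fintype V] [DecidableEq V] [DecidableRel G.Adj]
    {S : Finset V} (hdeg : ∀ x ∉ S, G.degree x ≤ 2) {r : V} (hr : r ∉ S) :
    ∃ T : Finset V, r ∈ T ∧ Disjoint T S ∧ (∀ x ∈ T, ∀ y, G.Adj x y → y ∈ T ∨ y ∈ S) ∧
      (G.interedges T Tᶜ).card ≤ 2 := by
  let F : Finset (Finset V) :=
    {T | r ∈ T ∧ Disjoint T S ∧ (G.interedges T Tᶜ).card ≤ 2}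
  have hF : {r} ∈ F := by
    simp only [F, Finset.mem_filter_univ, Finset.mem_singleton, true_and,
      Finset.disjoint_singleton_left]
    refine ⟨hr, ?_⟩
    have hsub : G.interedges {r} {r}ᶜ ⊆ (G.neighborFinset r).image (Prod.mk r) := by
      rintro ⟨z, w⟩ h
      simp only [SimpleGraph.mem_interedges_iff, Finset.mem_singleton] at h
      obtain ⟨rfl, -, h⟩ := h
      simpa using h
    have := (Finset.card_le_card hsub).trans Finset.card_image_le
    rw [G.card_neighborFinset_eq_degree] at this
    exact this.trans (hdeg r hr)
  obtain ⟨T, hTF, hmax⟩ := F.exists_max_image Finset.card ⟨_, hF⟩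
  simp only [F, Finset.mem_filter_univ] at hTF hmax
  obtain ⟨hrT, hdisj, hcard⟩ := hTF
  refine ⟨T, hrT, hdisj, fun x hx y hxy => ?_, hcard⟩
  by_contra! h
  have := hmax (insert y T) ⟨Finset.mem_insert_of_mem hrT,
    Finset.disjoint_insert_left.2 ⟨h.2, hdisj⟩,
    card_interedges_insert_le_two hcard hx h.1 hxy (hdeg y h.2)⟩
  rw [Finset.card_insert_of_notMem h.1] at this
  omega

/-- Two lazy cops win if all vertices other than `u` and `v` have degree at most two. -/
theorem lazyCopsWin_two_of_degree_le_two {G : SimpleGraph V} [Fintype V] [DecidableEq V]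
    [DecidableRel G.Adj] (hconn : G.Connected) {u v : V}
    (hdeg : ∀ x ∉ ({u, v} : Finset V), G.degree x ≤ 2) : LazyCopsWin G 2 := by
  refine ⟨![u, v], fun r => ?_⟩
  by_cases hr : r ∈ ({u, v} : Finset V)
  · rcases Finset.mem_insert.1 hr with rfl | h
    · exact .caught 0 rfl
    · exact .caught 1 (Finset.mem_singleton.1 h).symm
  obtain ⟨T, hrT, hdisj, hT, hcard⟩ := exists_territory hdeg hr
  have hu : u ∉ T := fun h => Finset.disjoint_left.1 hdisj h (by simp)
  have hv : v ∉ T := fun h => Finset.disjoint_left.1 hdisj h (by simp)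
  have hdegT : ∀ x ∈ T, G.degree x ≤ 2 := fun x hx => hdeg x (Finset.disjoint_left.1 hdisj hx)
  simp only [Finset.mem_insert, Finset.mem_singleton] at hT
  by_cases huv : u = v
  · exact lazyWinFrom_of_confined hconn (i := 0) (j := 1) (by decide) T hdegT _ r hu hv hT
      (.inl huv) hrT
  by_cases hone : ∀ x ∈ T, ∀ y ∈ T, G.Adj u x → G.Adj u y → x = y
  · exact lazyWinFrom_of_confined hconn (i := 0) (j := 1) (by decide) T hdegT _ r hu hv hT
      (.inr hone) hrT
  refine lazyWinFrom_of_confined hconn (i := 1) (j := 0) (by decide) T hdegT _ r hv hu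
    (fun x hx y hxy => (hT x hx y hxy).imp_right Or.symm) (.inr ?_) hrT
  intro z hz w hw hvz hvw
  exfalso
  push Not at hone
  obtain ⟨x, hx, y, hy, hux, huy, hxy⟩ := hone
  have : 2 < (G.interedges T Tᶜ).card := Finset.two_lt_card.2
    ⟨(x, u), by simp [SimpleGraph.mem_interedges_iff, hx, hu, hux.symm],
      (y, u), by simp [SimpleGraph.mem_interedges_iff, hy, hu, huy.symm],
      (z, v), by simpa [SimpleGraph.mem_interedges_iff, hz, hv] using hvz.symm,
      by simp [hxy], by simp [huv], by simp [huv]⟩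
  omega

theorem card_degree_ge_three_le {G : SimpleGraph V} [Fintype V] [DecidableRel G.Adj]
    (hδ : 2 ≤ G.minDegree) :
    2 * Fintype.card V + (Finset.univ.filter fun x => 3 ≤ G.degree x).card ≤
      2 * G.edgeFinset.card := by
  rw [← G.sum_degrees_eq_twice_card_edges, Finset.card_filter, ← Finset.card_univ, mul_comm,
    ← smul_eq_mul, ← Finset.sum_const, ← Finset.sum_add_distrib]
  refine Finset.sum_le_sum fun x _ => ?_
  have := hδ.trans (G.minDegree_le_degree x)
  split_ifs <;> omega

theorem exists_subset_pair_of_card_le_two [Nonempty V] [DecidableEq V] {S : Finset V}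
    (hS : S.card ≤ 2) : ∃ u v : V, S ⊆ {u, v} := by
  have h : S.card = 0 ∨ S.card = 1 ∨ S.card = 2 := by omega
  rcases h with h | h | h
  · obtain ⟨a⟩ := ‹Nonempty V›
    exact ⟨a, a, by simp [Finset.card_eq_zero.1 h]⟩
  · obtain ⟨a, rfl⟩ := Finset.card_eq_one.1 h
    exact ⟨a, a, by simp⟩
  · obtain ⟨a, b, -, rfl⟩ := Finset.card_eq_two.1 h
    exact ⟨a, b, subset_rfl⟩

/-- `G` connected on 9 vertices with `δ(G) ≥ 2`, `Δ(G) ≤ 3` and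
at most 10 edges has `c_L(G) ≤ 2`. -/
theorem lazyCopNumber_le_two_of_at_most_ten_edges
    {V : Type*} [Fintype V] [DecidableEq V] [Nonempty V] (G : SimpleGraph V)
    [DecidableRel G.Adj] (hconn : G.Connected)
    (hcard : Fintype.card V = 9)
    (hδ : 2 ≤ G.minDegree) (hΔ : G.maxDegree ≤ 3)
    (hE : G.edgeFinset.card ≤ 10) :
    lazyCopNumber G ≤ 2 := by
  have hS := card_degree_ge_three_le hδ
  obtain ⟨u, v, huv⟩ := exists_subset_pair_of_card_le_two
    (S := Finset.univ.filter fun x => 3 ≤ G.degree x) (by omega)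
  refine Nat.sInf_le (lazyCopsWin_two_of_degree_le_two hconn (u := u) (v := v) fun x hx => ?_)
  by_contra! h
  exact hx (huv (Finset.mem_filter.2 ⟨Finset.mem_univ x, h⟩))

end CopsRobbers
end

section
/- Let G be a finite connected simple graph on 9 vertices with 2 ≤ δ(G) ≤ Δ(G) ≤ 3. If there exist vertices u₁, u₂, both of degree 3, such that N̄(u₁) ∩ N̄(u₂) = ∅, then c_L(G) ≤ 2. -/
/-!
Cops and robbers on a simple graph `G`.

A *configuration* consists of the positions of the `k` cops (a function
`Fin k → V`) together with the robber's position, with the cops to move.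
The cops win if at some point a cop occupies the robber's vertex.
-/

namespace CopsRobbers

variable {V : Type*}

/-- A lazy cop adjacent to the robber catches him at once. -/
lemma LazyWinFrom.of_adj {G : SimpleGraph V} {k : ℕ} {c : Fin k → V} {r : V} (i : Fin k)
    (h : G.Adj (c i) r) : LazyWinFrom G c r :=
  .stepCatch (Function.update c i r) i (by simp [h])
    (fun j hj => Function.update_of_ne hj _ _) i (by simp)

/-- If a cop on `b` covers every escape from the robber's vertex `w`, the other cop can walk
to `w` and catch him. -/
lemma lazyWinFrom_of_walk_of_guarded {G : SimpleGraph V} {a b w : V} (p : G.Walk a w)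
    (hguard : ∀ y, G.Adj w y → G.Adj b y) : LazyWinFrom G ![a, b] w := by
  induction p with
  | nil => exact .caught 0 rfl
  | @cons a a' w h p ih =>
    refine .step ![a', b] 0 (Or.inr h) (fun i hi => ?_) ?_
    · match i, hi with
      | 1, _ => rfl
    · rintro r' (rfl | hr)
      · exact ih hguard
      · exact .of_adj 1 (hguard r' hr)

/-- If `a` and `b` dominate every vertex except `w`, and `w` has at most one neighbor not
covered by `b`, that neighbor being adjacent to `a`, then two lazy cops win. -/
lemma lazyCopsWin_two_of_dominated_except {G : SimpleGraph V} (hconn : G.Connected) {a b w : V}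
    (hdom : ∀ v, v = w ∨ (v = a ∨ G.Adj a v) ∨ (v = b ∨ G.Adj b v))
    (hw : (∀ y, G.Adj w y → G.Adj b y) ∨
      ∃ x, G.Adj a x ∧ G.Adj w x ∧ ∀ y, G.Adj w y → y = x ∨ G.Adj b y) :
    LazyCopsWin G 2 := by
  refine ⟨![a, b], fun r => ?_⟩
  obtain rfl | (rfl | hr) | (rfl | hr) := hdom r
  · obtain hguard | ⟨x, hax, hrx, hx⟩ := hw
    · obtain ⟨p⟩ := hconn.preconnected a r
      exact lazyWinFrom_of_walk_of_guarded p hguard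
    · refine .step ![x, b] 0 (Or.inr hax) (fun i hi => ?_) ?_
      · match i, hi with
        | 1, _ => rfl
      · rintro y (rfl | hy)
        · exact .of_adj 0 hrx.symm
        · obtain rfl | hby := hx y hy
          · exact .caught 0 rfl
          · exact .of_adj 1 hby
  · exact .caught 0 rfl
  · exact .of_adj 0 hr
  · exact .caught 1 rfl
  · exact .of_adj 1 hr

/-- 9 vertices, `2 ≤ δ(G) ≤ Δ(G) ≤ 3`, and two degree-3 vertices
whose closed neighborhoods are disjoint imply `c_L(G) ≤ 2`. -/
theorem lazy_le_two_of_disjoint_closed_neighborhoods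
    {V : Type*} [Fintype V] [Nonempty V] (G : SimpleGraph V)
    [DecidableRel G.Adj] (hconn : G.Connected)
    (hcard : Fintype.card V = 9)
    (hδ : 2 ≤ G.minDegree) (hΔ : G.maxDegree ≤ 3)
    (u₁ u₂ : V) (h1 : G.degree u₁ = 3) (h2 : G.degree u₂ = 3)
    (hN : insert u₁ (G.neighborSet u₁) ∩ insert u₂ (G.neighborSet u₂) =
      (∅ : Set V)) :
    lazyCopNumber G ≤ 2 := by
  classical
  refine Nat.sInf_le (show LazyCopsWin G 2 from ?_)
  set A := G.neighborFinset u₁ with hA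
  set B := G.neighborFinset u₂ with hB
  have hdisj : Disjoint (insert u₁ A) (insert u₂ B) := by
    rw [← Finset.disjoint_coe, Set.disjoint_iff_inter_eq_empty]
    simpa [hA, hB] using hN
  have hcompl : ((insert u₁ A ∪ insert u₂ B)ᶜ).card = 1 := by
    rw [Finset.card_compl, Finset.card_union_of_disjoint hdisj,
      Finset.card_insert_of_notMem (by simp [hA]), Finset.card_insert_of_notMem (by simp [hB]),
      hA, hB, G.card_neighborFinset_eq_degree, G.card_neighborFinset_eq_degree, h1, h2, hcard]
  obtain ⟨w, hw⟩ := Finset.card_eq_one.mp hcompl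
  have hmem (v : V) : v = w ↔ ¬ ((v = u₁ ∨ G.Adj u₁ v) ∨ (v = u₂ ∨ G.Adj u₂ v)) := by
    rw [← Finset.mem_singleton, ← hw]
    simp [hA, hB]
    tauto
  have hdom (v : V) : v = w ∨ (v = u₁ ∨ G.Adj u₁ v) ∨ (v = u₂ ∨ G.Adj u₂ v) := by
    have := hmem v
    tauto
  have hwN := (hmem w).mp rfl
  have hNw {y : V} (hy : G.Adj w y) : G.Adj u₁ y ∨ G.Adj u₂ y := by
    obtain rfl | (rfl | h) | (rfl | h) := hdom y
    · exact absurd hy G.irrefl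
    · exact absurd (Or.inl (Or.inr hy.symm)) hwN
    · exact Or.inl h
    · exact absurd (Or.inr (Or.inr hy.symm)) hwN
    · exact Or.inr h
  have hle : (G.neighborFinset w ∩ A).card + (G.neighborFinset w ∩ B).card ≤ 3 := by
    rw [← Finset.card_union_of_disjoint]
    · refine (Finset.card_le_card (Finset.union_subset Finset.inter_subset_left
        Finset.inter_subset_left)).trans ?_
      rw [G.card_neighborFinset_eq_degree]
      exact (G.degree_le_maxDegree w).trans hΔ
    · exact hdisj.mono (Finset.inter_subset_right.trans (Finset.subset_insert _ _))
        (Finset.inter_subset_right.trans (Finset.subset_insert _ _))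
  have hside {a b : V} (hab : ∀ {y}, G.Adj w y → G.Adj a y ∨ G.Adj b y)
      (hcard : (G.neighborFinset w ∩ G.neighborFinset a).card ≤ 1) :
      (∀ y, G.Adj w y → G.Adj b y) ∨
        ∃ x, G.Adj a x ∧ G.Adj w x ∧ ∀ y, G.Adj w y → y = x ∨ G.Adj b y := by
    rw [Finset.card_le_one] at hcard
    simp only [Finset.mem_inter, SimpleGraph.mem_neighborFinset] at hcard
    by_cases hx : ∃ x, G.Adj w x ∧ G.Adj a x
    · obtain ⟨x, hwx, hax⟩ := hx
      exact Or.inr ⟨x, hax, hwx, fun y hy => (hab hy).imp_left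
        fun hay => hcard y ⟨hy, hay⟩ x ⟨hwx, hax⟩⟩
    · exact Or.inl fun y hy => (hab hy).resolve_left fun hay => hx ⟨y, hy, hay⟩
  obtain h | h : (G.neighborFinset w ∩ A).card ≤ 1 ∨ (G.neighborFinset w ∩ B).card ≤ 1 := by
    omega
  · exact lazyCopsWin_two_of_dominated_except hconn hdom (hside hNw h)
  · exact lazyCopsWin_two_of_dominated_except hconn (fun v => (hdom v).imp_right Or.symm)
      (hside (fun hy => (hNw hy).symm) h)

end CopsRobbers
end
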